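/- Let (R,m) be a Cohen-Macaulay local ring of Krull dimension n and let C be a semidualizing R-module. Then the following conditions are equivalent: (i) C is a dualizing R-module; (ii) H_m^n(R) is a C-injective R-module; (iii) H_m^n(R) is a G_C-injective R-module; (iv) the G_C-injective dimension of H_m^n(R) is finite. -/

import Mathlib

/-!
Common definitions: semidualizing modules, `C`-injective modules and dimensions,
`G_C`-injective modules, Bass/Auslander classes, relative Cohen-Macaulayness,
Cohen-Macaulay and Gorenstein local rings, trivial extensions, ideal torsion.
-/

noncomputable section

open CategoryTheory TensorProduct

universe u

variable (R : Type u) [CommRing R]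

/-- An `R`-module `M` is `C`-injective if it is isomorphic to `Hom_R(C, I)`
for some injective `R`-module `I`. -/
def IsCInjective (C M : ModuleCat.{u} R) : Prop :=
  ∃ I : ModuleCat.{u} R, Module.Injective R I ∧ Nonempty (M ≃ₗ[R] (C →ₗ[R] I))

/-- `HasCoresDimLE R P n M` : the module `M` admits a coresolution of length at most `n`
by modules satisfying the property `P`. -/
def HasCoresDimLE (P : ModuleCat.{u} R → Prop) : ℕ → ModuleCat.{u} R → Prop
  | 0, M => Subsingleton M ∨ P M
  | n + 1, M => Subsingleton M ∨ ∃ (X : ModuleCat.{u} R) (f : M →ₗ[R] X),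
      P X ∧ Function.Injective f ∧
        HasCoresDimLE P n (ModuleCat.of R (X ⧸ LinearMap.range f))

/-- The coresolution dimension of `M` with respect to the class of modules satisfying `P`,
as an element of `ℕ∞` (`⊤` meaning no finite coresolution exists). -/
def coresDim (P : ModuleCat.{u} R → Prop) (M : ModuleCat.{u} R) : ℕ∞ :=
  sInf {d : ℕ∞ | ∃ n : ℕ, d = n ∧ HasCoresDimLE R P n M}

/-- The `C`-injective dimension of `M`. -/
def cinjDim (C M : ModuleCat.{u} R) : ℕ∞ :=
  coresDim R (IsCInjective R C) M

/-- The injective dimension of `M`. -/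
def injDim (M : ModuleCat.{u} R) : ℕ∞ :=
  coresDim R (fun N => Module.Injective R N) M

/-- A finitely generated `R`-module `C` is semidualizing if the natural map
`R → Hom_R(C,C)` is bijective and `Ext_R^i(C,C) = 0` for all `i ≥ 1`. -/
def IsSemidualizing (C : ModuleCat.{u} R) : Prop :=
  Module.Finite R C ∧ Function.Bijective (LinearMap.lsmul R C) ∧
    ∀ i : ℕ, 1 ≤ i →
      Subsingleton (((Ext R (ModuleCat.{u} R) i).obj (Opposite.op C)).obj C)

/-- A dualizing module is a semidualizing module of finite injective dimension. -/
def IsDualizing (C : ModuleCat.{u} R) : Prop :=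
  IsSemidualizing R C ∧ injDim R C ≠ ⊤

/-- A complete `I_C I`-resolution: an exact complex `Y` (with `d i : Y (i+1) → Y i`)
which stays exact after applying `Hom_R(I, -)` for every `C`-injective `I`, whose terms
in positive degrees are `C`-injective and whose terms in degrees `≤ 0` are injective. -/
structure CompleteICIResolution (C : ModuleCat.{u} R) where
  Y : ℤ → ModuleCat.{u} R
  d : (i : ℤ) → (Y (i + 1) →ₗ[R] Y i)
  exact : ∀ i : ℤ, Function.Exact (d (i + 1)) (d i)
  cinj_pos : ∀ i : ℤ, 0 < i → IsCInjective R C (Y i)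
  inj_nonpos : ∀ i : ℤ, i ≤ 0 → Module.Injective R (Y i)
  homExact : ∀ I : ModuleCat.{u} R, IsCInjective R C I → ∀ i : ℤ,
    Function.Exact (fun f : I →ₗ[R] Y (i + 1 + 1) => (d (i + 1)).comp f)
      (fun f : I →ₗ[R] Y (i + 1) => (d i).comp f)

/-- A module is `G_C`-injective if it is the kernel of the degree-`0` differential of some
complete `I_C I`-resolution. -/
def IsGCInjective (C M : ModuleCat.{u} R) : Prop :=
  ∃ res : CompleteICIResolution R C,
    Nonempty (M ≃ₗ[R] ↥(LinearMap.ker (res.d (-1))))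

/-- The `G_C`-injective dimension of `M`. -/
def gcinjDim (C M : ModuleCat.{u} R) : ℕ∞ :=
  coresDim R (IsGCInjective R C) M

/-- `M` is relative Cohen-Macaulay with respect to `a`: there is exactly one
non-vanishing local cohomology module of `M` with respect to `a`. -/
def IsRelativeCM (a : Ideal R) (M : ModuleCat.{u} R) : Prop :=
  ∃! n : ℕ, Nontrivial ((localCohomology a n).obj M)

/-- `M` is relative Cohen-Macaulay with respect to `a`, with (unique) non-vanishing
local cohomology in degree `n`. -/
def IsRelativeCMAt (a : Ideal R) (n : ℕ) (M : ModuleCat.{u} R) : Prop :=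
  Nontrivial ((localCohomology a n).obj M) ∧
    ∀ i : ℕ, i ≠ n → Subsingleton ((localCohomology a i).obj M)

/-- The cohomological dimension `cd(a, M)`: the largest `i` with `H_a^i(M) ≠ 0`. -/
def lcCohomDim (a : Ideal R) (M : ModuleCat.{u} R) : ℕ :=
  sSup {i : ℕ | Nontrivial ((localCohomology a i).obj M)}

/-- The grade `grade(a, M)`: the least `i` with `H_a^i(M) ≠ 0`. -/
def lcGrade (a : Ideal R) (M : ModuleCat.{u} R) : ℕ :=
  sInf {i : ℕ | Nontrivial ((localCohomology a i).obj M)}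

/-- A Noetherian local ring is Cohen-Macaulay iff `H_m^i(R) = 0` for all `i ≠ dim R`
(Grothendieck's characterization, taken here as the definition). -/
def IsCohenMacaulayLocalRing (S : Type u) [CommRing S] [IsLocalRing S] : Prop :=
  ∀ i : ℕ, (i : WithBot ℕ∞) ≠ ringKrullDim S →
    Subsingleton ((localCohomology (IsLocalRing.maximalIdeal S) i).obj (ModuleCat.of S S))

/-- A local ring is Gorenstein if it has finite injective dimension over itself. -/
def IsGorensteinLocalRing (S : Type u) [CommRing S] : Prop :=
  injDim S (ModuleCat.of S S) ≠ ⊤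

/-- The `a`-torsion submodule `Γ_a(M)` of `M`. -/
def idealTorsion (a : Ideal R) (M : Type u) [AddCommGroup M] [Module R M] :
    Submodule R M :=
  ⨆ n : ℕ, Submodule.torsionBySet R M ((a ^ n : Ideal R) : Set R)

/-- The Krull dimension of a module, `dim_S N = dim (S / ann_S N)`. -/
def moduleKrullDim (S : Type u) [CommRing S] (N : Type u) [AddCommGroup N] [Module S N] :
    WithBot ℕ∞ :=
  ringKrullDim (S ⧸ Module.annihilator S N)

/-- `ht_M(a) = inf { dim_{R_p} M_p  |  p ∈ Supp (M / a M) }`. -/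
def heightWRT (a : Ideal R) (M : Type u) [AddCommGroup M] [Module R M] : WithBot ℕ∞ :=
  ⨅ (p : PrimeSpectrum R) (_ : p ∈ Module.support R (M ⧸ (a • (⊤ : Submodule R M)))),
    moduleKrullDim (Localization.AtPrime p.asIdeal) (LocalizedModule p.asIdeal.primeCompl M)

/-- Membership in the Bass class `B_C(R)`. -/
def MemBassClass (C M : ModuleCat.{u} R) : Prop :=
  (∀ i : ℕ, 1 ≤ i →
      Subsingleton (((Ext R (ModuleCat.{u} R) i).obj (Opposite.op C)).obj M)) ∧
  (∀ i : ℕ, 1 ≤ i →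
      Subsingleton (((Tor (ModuleCat.{u} R) i).obj C).obj (ModuleCat.of R (C →ₗ[R] M)))) ∧
  Function.Bijective
    (TensorProduct.lift ((LinearMap.id : (C →ₗ[R] M) →ₗ[R] (C →ₗ[R] M)).flip))

/-- Membership in the Auslander class `A_C(R)`. -/
def MemAuslanderClass (C M : ModuleCat.{u} R) : Prop :=
  (∀ i : ℕ, 1 ≤ i →
      Subsingleton (((Tor (ModuleCat.{u} R) i).obj C).obj M)) ∧
  (∀ i : ℕ, 1 ≤ i →
      Subsingleton (((Ext R (ModuleCat.{u} R) i).obj (Opposite.op C)).obj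
        (ModuleCat.of R (↥C ⊗[R] ↥M)))) ∧
  Function.Bijective ((TensorProduct.mk R ↥C ↥M).flip)

/-- `HasResDimLE R P n M` : `M` admits a resolution of length at most `n`
by modules satisfying `P`. -/
def HasResDimLE (P : ModuleCat.{u} R → Prop) : ℕ → ModuleCat.{u} R → Prop
  | 0, M => Subsingleton M ∨ P M
  | n + 1, M => Subsingleton M ∨ ∃ (X : ModuleCat.{u} R) (f : X →ₗ[R] M),
      P X ∧ Function.Surjective f ∧
        HasResDimLE P n (ModuleCat.of R ↥(LinearMap.ker f))

/-- The projective dimension of `M`. -/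
def projDim (M : ModuleCat.{u} R) : ℕ∞ :=
  sInf {d : ℕ∞ | ∃ n : ℕ, d = n ∧ HasResDimLE R (fun N => Module.Projective R N) n M}

/-- The first projection of the trivial extension `R ⋉ C`, as a ring homomorphism. -/
def trivExtFst (C : Type u) [AddCommGroup C] [Module R C] [Module Rᵐᵒᵖ C]
    [IsCentralScalar R C] : TrivSqZeroExt R C →+* R where
  toFun := TrivSqZeroExt.fst
  map_one' := TrivSqZeroExt.fst_one (R := R) (M := C)
  map_mul' := TrivSqZeroExt.fst_mul
  map_zero' := TrivSqZeroExt.fst_zero (R := R) (M := C)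
  map_add' := TrivSqZeroExt.fst_add

/-- The ideal `a ⊕ C` of the trivial extension `R ⋉ C`. -/
def trivExtIdeal (a : Ideal R) (C : Type u) [AddCommGroup C] [Module R C] [Module Rᵐᵒᵖ C]
    [IsCentralScalar R C] : Ideal (TrivSqZeroExt R C) :=
  Ideal.comap (trivExtFst R C) a

/-- An `R`-module `M`, viewed as a module over the trivial extension `R ⋉ C` via the
natural surjection `R ⋉ C → R`. -/
def trivExtModuleCat (C : Type u) [AddCommGroup C] [Module R C] [Module Rᵐᵒᵖ C]
    [IsCentralScalar R C] (M : Type u) [AddCommGroup M] [Module R M] :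
    ModuleCat.{u} (TrivSqZeroExt R C) :=
  letI := Module.compHom M (trivExtFst R C)
  ModuleCat.of (TrivSqZeroExt R C) M

end

section

set_option autoImplicit false

universe u

open CategoryTheory Pointwise TensorProduct

section

namespace CategoryTheory.ProjectiveResolution

variable {R : Type u} [CommRing R] {X : ModuleCat.{u} R} (P : ProjectiveResolution X)
  (n : ℕ) (Y : ModuleCat.{u} R)

/-- The `n`-cocycles of `Hom(P, Y)`. -/
def homCocycles : Submodule R (P.complex.X n ⟶ Y) :=
  LinearMap.ker (Linear.leftComp R Y (P.complex.d (n + 1) n))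

lemma mem_homCocycles {f : P.complex.X n ⟶ Y} :
    f ∈ P.homCocycles n Y ↔ P.complex.d (n + 1) n ≫ f = 0 := Iff.rfl

/-- The class in `Ext X Y n` of a cocycle. -/
noncomputable def extMkLinear : P.homCocycles n Y →ₗ[R] Abelian.Ext X Y n where
  toFun f := P.extMk f.1 (n + 1) rfl f.2
  map_add' f g := (P.add_extMk f.1 g.1 (n + 1) rfl f.2 g.2).symm
  map_smul' r f := by
    have h := P.extMk_comp_mk₀ f.1 (n + 1) rfl f.2 (r • 𝟙 Y)
    rw [Abelian.Ext.mk₀_smul, Abelian.Ext.comp_smul, Abelian.Ext.comp_mk₀_id] at h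
    simp only [Submodule.coe_smul, RingHom.id_apply]
    rw [h]
    congr 1

lemma extMkLinear_surjective : Function.Surjective (P.extMkLinear n Y) := fun α ↦ by
  obtain ⟨f, hf, rfl⟩ := P.extMk_surjective α (n + 1) rfl
  exact ⟨⟨f, hf⟩, rfl⟩

lemma extMkLinear_eq_zero_iff (f : P.homCocycles n Y) :
    P.extMkLinear n Y f = 0 ↔
      ∃ g, P.complex.d n ((ComplexShape.down ℕ).next n) ≫ g = f.1 := by
  rcases n with _ | n
  · have h0 : P.complex.d 0 ((ComplexShape.down ℕ).next 0) = 0 :=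
      P.complex.shape _ _ (by simp [ComplexShape.down])
    simp only [h0, Limits.zero_comp, exists_const]
    refine ⟨fun h ↦ ?_, fun h ↦ ?_⟩
    · replace h : P.extMk f.1 1 rfl ((P.mem_homCocycles _ _).1 f.2) = 0 := h
      rw [← P.extEquivCohomologyClass.apply_eq_iff_eq, extEquivCohomologyClass_extMk,
        extEquivCohomologyClass_zero, CochainComplex.HomComplex.CohomologyClass.mk_eq_zero_iff,
        CochainComplex.HomComplex.Cocycle.toSingleMk_mem_coboundaries_iff _ _ _ _ _ 1 (by simp)]
        at h
      obtain ⟨g, hg⟩ := h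
      have hz : Limits.IsZero (P.cochainComplex.X 1) :=
        P.cochainComplex.isZero_of_isStrictlyLE 0 1 (by simp)
      rw [hz.eq_of_tgt (P.cochainComplex.d (-((0 : ℕ) : ℤ)) 1) 0, Limits.zero_comp] at hg
      rw [← cancel_epi (P.cochainComplexXIso (-((0 : ℕ) : ℤ)) 0 rfl).hom, Limits.comp_zero]
      exact hg
    · have : f = 0 := Subtype.ext h.symm
      rw [this, map_zero]
  · rw [ChainComplex.next_nat_succ]
    exact P.extMk_eq_zero_iff f.1 (n + 2) rfl f.2 n rfl

/-- The complex `Hom(P, Y)`, as a chain complex in the opposite category. -/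
noncomputable abbrev homComplexOp : ChainComplex (ModuleCat.{u} R)ᵒᵖ ℕ :=
  ((((linearYoneda R (ModuleCat.{u} R)).obj Y).rightOp).mapHomologicalComplex _).obj P.complex

/-- The inclusion of cocycles, in the opposite category. -/
noncomputable def homCocyclesι : (P.homComplexOp Y).X n ⟶
    Opposite.op (ModuleCat.of R (P.homCocycles n Y)) :=
  Quiver.Hom.op (X := ModuleCat.of R (P.homCocycles n Y))
    (Y := ModuleCat.of R (P.complex.X n ⟶ Y)) (ModuleCat.ofHom (P.homCocycles n Y).subtype)

lemma d_comp_homCocyclesι : (P.homComplexOp Y).d (n + 1) n ≫ P.homCocyclesι n Y = 0 := by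
  apply Quiver.Hom.unop_inj
  ext f
  exact f.2

/-- The class of a cocycle in the left derived functor of `Hom(-, Y)`, as a morphism of
the opposite category. -/
noncomputable def oldExtOp :
    ((((linearYoneda R (ModuleCat.{u} R)).obj Y).rightOp).leftDerived n).obj X ⟶
      Opposite.op (ModuleCat.of R (P.homCocycles n Y)) :=
  (P.isoLeftDerivedObj ((linearYoneda R (ModuleCat.{u} R)).obj Y).rightOp n).hom ≫
    (P.homComplexOp Y).homologyι n ≫
      (P.homComplexOp Y).descOpcycles (P.homCocyclesι n Y) (n + 1) (by simp)
        (P.d_comp_homCocyclesι n Y)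

/-- The class of a cocycle in the left derived functor of `Hom(-, Y)`. -/
noncomputable def oldExtMk : P.homCocycles n Y →ₗ[R]
    ((Ext R (ModuleCat.{u} R) n).obj (Opposite.op X)).obj Y :=
  (P.oldExtOp n Y).unop.hom

lemma pOpcycles_unop_descOpcycles_unop (f : P.homCocycles n Y) :
    ((P.homComplexOp Y).pOpcycles n).unop.hom
      (((P.homComplexOp Y).descOpcycles (P.homCocyclesι n Y) (n + 1) (by simp)
        (P.d_comp_homCocyclesι n Y)).unop.hom f) = f.1 := by
  have h := (P.homComplexOp Y).p_descOpcycles (P.homCocyclesι n Y) (n + 1) (by simp)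
        (P.d_comp_homCocyclesι n Y)
  have h2 := congr_arg (fun k ↦ k.unop.hom f) h
  exact h2

lemma oldExtMk_apply (f : P.homCocycles n Y) : P.oldExtMk n Y f =
    (P.isoLeftDerivedObj ((linearYoneda R (ModuleCat.{u} R)).obj Y).rightOp n).hom.unop.hom
      (((P.homComplexOp Y).homologyι n).unop.hom
        (((P.homComplexOp Y).descOpcycles (P.homCocyclesι n Y) (n + 1) (by simp)
        (P.d_comp_homCocyclesι n Y)).unop.hom f)) := rfl

lemma pOpcycles_unop_injective :
    Function.Injective ((P.homComplexOp Y).pOpcycles n).unop.hom :=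
  (ModuleCat.mono_iff_injective _).1 inferInstance

lemma oldExtMk_surjective : Function.Surjective (P.oldExtMk n Y) := by
  intro y
  have h1 : Function.Surjective (P.isoLeftDerivedObj
      ((linearYoneda R (ModuleCat.{u} R)).obj Y).rightOp n).hom.unop.hom :=
    (ModuleCat.epi_iff_surjective _).1 inferInstance
  have h2 : Function.Surjective ((P.homComplexOp Y).homologyι n).unop.hom :=
    (ModuleCat.epi_iff_surjective _).1 inferInstance
  obtain ⟨y, rfl⟩ := h1 y
  obtain ⟨z, rfl⟩ := h2 y
  have hz : P.complex.d (n + 1) n ≫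
      (((P.homComplexOp Y).pOpcycles n).unop.hom z : P.complex.X n ⟶ Y) = 0 := by
    have h := (P.homComplexOp Y).d_pOpcycles (n + 1) n
    exact congr_arg (fun k ↦ k.unop.hom z) h
  refine ⟨⟨_, hz⟩, ?_⟩
  rw [oldExtMk_apply]
  congr 2
  apply P.pOpcycles_unop_injective
  rw [pOpcycles_unop_descOpcycles_unop]

lemma oldExtMk_eq_zero_iff (f : P.homCocycles n Y) :
    P.oldExtMk n Y f = 0 ↔
      ∃ g, P.complex.d n ((ComplexShape.down ℕ).next n) ≫ g = f.1 := by
  have h1 : Function.Injective (P.isoLeftDerivedObj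
      ((linearYoneda R (ModuleCat.{u} R)).obj Y).rightOp n).hom.unop.hom :=
    (ModuleCat.mono_iff_injective _).1 inferInstance
  have hS : (ShortComplex.mk ((P.homComplexOp Y).homologyι n)
      ((P.homComplexOp Y).fromOpcycles n ((ComplexShape.down ℕ).next n)) (by simp)).Exact :=
    ShortComplex.exact_of_f_is_kernel _ ((P.homComplexOp Y).homologyIsKernel _ _ rfl)
  have hS' := (ShortComplex.moduleCat_exact_iff _).1 hS.unop
  have hd : ∀ g, ((P.homComplexOp Y).pOpcycles n).unop.hom
      (((P.homComplexOp Y).fromOpcycles n ((ComplexShape.down ℕ).next n)).unop.hom g) =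
      P.complex.d n ((ComplexShape.down ℕ).next n) ≫ g := fun g ↦ by
    have h := (P.homComplexOp Y).p_fromOpcycles n ((ComplexShape.down ℕ).next n)
    exact congr_arg (fun k ↦ k.unop.hom g) h
  refine (map_eq_zero_iff (P.isoLeftDerivedObj
      ((linearYoneda R (ModuleCat.{u} R)).obj Y).rightOp n).hom.unop.hom h1).trans ?_
  constructor
  · intro h
    obtain ⟨g, hg⟩ := hS' _ h
    refine ⟨g, (hd g).symm.trans (Eq.trans ?_ (P.pOpcycles_unop_descOpcycles_unop n Y f))⟩
    exact congr_arg _ hg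
  · rintro ⟨g, hg⟩
    replace hg := P.pOpcycles_unop_injective n Y
      (((hd g).trans hg).trans (P.pOpcycles_unop_descOpcycles_unop n Y f).symm)
    have h := (P.homComplexOp Y).homologyι_comp_fromOpcycles n ((ComplexShape.down ℕ).next n)
    exact (congr_arg ((P.homComplexOp Y).homologyι n).unop.hom hg.symm).trans
      (congr_arg (fun k ↦ k.unop.hom g) h)

variable {P n Y} in
lemma oldExtMk_naturality {X' : ModuleCat.{u} R} {P' : ProjectiveResolution X'} {g : X' ⟶ X}
    (φ : Hom P' P g) (f : P.homCocycles n Y) (f' : P'.homCocycles n Y)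
    (hf : f'.1 = φ.hom.f n ≫ f.1) :
    ((Ext R (ModuleCat.{u} R) n).map g.op).app Y (P.oldExtMk n Y f) = P'.oldExtMk n Y f' := by
  have h := isoLeftDerivedObj_hom_naturality g P' P φ.hom φ.hom_f_zero_comp_π_f_zero
    ((linearYoneda R (ModuleCat.{u} R)).obj Y).rightOp n
  have h2 := congr_arg (fun k ↦ k.unop.hom (((P.homComplexOp Y).homologyι n).unop.hom
        (((P.homComplexOp Y).descOpcycles (P.homCocyclesι n Y) (n + 1) (by simp)
        (P.d_comp_homCocyclesι n Y)).unop.hom f))) h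
  refine h2.trans ?_
  rw [oldExtMk_apply]
  refine congr_arg (P'.isoLeftDerivedObj
      ((linearYoneda R (ModuleCat.{u} R)).obj Y).rightOp n).hom.unop.hom ?_
  let ψ : P'.homComplexOp Y ⟶ P.homComplexOp Y :=
    ((((linearYoneda R (ModuleCat.{u} R)).obj Y).rightOp).mapHomologicalComplex _).map φ.hom
  have h3 := congr_arg (fun k ↦ k.unop.hom (((P.homComplexOp Y).descOpcycles
    (P.homCocyclesι n Y) (n + 1) (by simp) (P.d_comp_homCocyclesι n Y)).unop.hom f))
    (HomologicalComplex.homologyι_naturality ψ n)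
  refine h3.trans ?_
  refine congr_arg (((P'.homComplexOp Y).homologyι n).unop.hom) ?_
  apply P'.pOpcycles_unop_injective
  rw [pOpcycles_unop_descOpcycles_unop, hf]
  have h4 := congr_arg (fun k ↦ k.unop.hom (((P.homComplexOp Y).descOpcycles
    (P.homCocyclesι n Y) (n + 1) (by simp) (P.d_comp_homCocyclesι n Y)).unop.hom f))
    (HomologicalComplex.p_opcyclesMap ψ n)
  refine h4.trans ?_
  have h5 := pOpcycles_unop_descOpcycles_unop P n Y f
  exact congr_arg (ψ.f n).unop.hom h5

/-- Comparison of the two constructions of `Ext` through a projective resolution. -/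
noncomputable def extComparison :
    (((Ext R (ModuleCat.{u} R) n).obj (Opposite.op X)).obj Y) ≃ₗ[R] Abelian.Ext X Y n :=
  ((P.oldExtMk n Y).quotKerEquivOfSurjective (P.oldExtMk_surjective n Y)).symm ≪≫ₗ
    Submodule.quotEquivOfEq _ _ (by
      ext f
      rw [LinearMap.mem_ker, LinearMap.mem_ker, oldExtMk_eq_zero_iff,
        extMkLinear_eq_zero_iff]) ≪≫ₗ
    (P.extMkLinear n Y).quotKerEquivOfSurjective (P.extMkLinear_surjective n Y)

lemma extComparison_oldExtMk (f : P.homCocycles n Y) :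
    P.extComparison n Y (P.oldExtMk n Y f) = P.extMkLinear n Y f := by
  have : ((P.oldExtMk n Y).quotKerEquivOfSurjective (P.oldExtMk_surjective n Y)).symm
      (P.oldExtMk n Y f) = Submodule.Quotient.mk f := by
    rw [LinearEquiv.symm_apply_eq]; rfl
  simp only [extComparison, LinearEquiv.trans_apply, this]
  rfl

end CategoryTheory.ProjectiveResolution

/-- The comparison between `Ext`, as a derived functor, and `Abelian.Ext`. -/
noncomputable def extComparison {R : Type u} [CommRing R] (X Y : ModuleCat.{u} R) (n : ℕ) :
    (((Ext R (ModuleCat.{u} R) n).obj (Opposite.op X)).obj Y) ≃ₗ[R] Abelian.Ext X Y n :=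
  (projectiveResolution X).extComparison n Y

lemma extComparison_naturality {R : Type u} [CommRing R] {X X' : ModuleCat.{u} R} (g : X' ⟶ X)
    (Y : ModuleCat.{u} R) (n : ℕ)
    (α : (((Ext R (ModuleCat.{u} R) n).obj (Opposite.op X)).obj Y)) :
    extComparison X' Y n (((Ext R (ModuleCat.{u} R) n).map g.op).app Y α) =
      (Abelian.Ext.mk₀ g).comp (extComparison X Y n α) (zero_add n) := by
  obtain ⟨f, rfl⟩ := (projectiveResolution X).oldExtMk_surjective n Y α
  let φ : ProjectiveResolution.Hom (projectiveResolution X') (projectiveResolution X) g :=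
    { hom := ProjectiveResolution.lift g _ _
      hom_f_zero_comp_π_f_zero := ProjectiveResolution.lift_commutes_zero g _ _ }
  have hφ : φ.hom.f n ≫ f.1 ∈ (projectiveResolution X').homCocycles n Y := by
    rw [ProjectiveResolution.mem_homCocycles, ← φ.hom.comm_assoc]
    rw [(ProjectiveResolution.mem_homCocycles _ _ _).1 f.2, Limits.comp_zero]
  rw [ProjectiveResolution.oldExtMk_naturality φ f ⟨_, hφ⟩ rfl]
  unfold extComparison
  rw [ProjectiveResolution.extComparison_oldExtMk, ProjectiveResolution.extComparison_oldExtMk]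
  exact (ProjectiveResolution.mk₀_comp_extMk f.1 (n + 1) rfl f.2 φ).symm

end

namespace localCohomology

variable {R : Type u} [CommRing R] (J : Ideal R) (i : ℕ) (Y : ModuleCat.{u} R)

/-- The projection `R ⧸ J ^ s → R ⧸ J ^ t` for `t ≤ s`. -/
def powProj {t s : ℕ} (h : t ≤ s) :
    ModuleCat.of R (R ⧸ J ^ s) ⟶ ModuleCat.of R (R ⧸ J ^ t) :=
  ModuleCat.ofHom (Submodule.mapQ _ _ LinearMap.id (Ideal.pow_le_pow_right h))

/-- The colimit cocone defining `localCohomology J i` evaluated at `Y`. -/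
noncomputable def evalIsColimit : Limits.IsColimit
    (((evaluation (ModuleCat.{u} R) (ModuleCat.{u} R)).obj Y).mapCocone
      (Limits.colimit.cocone (diagram (idealPowersDiagram J) i))) :=
  Limits.isColimitOfPreserves ((evaluation (ModuleCat.{u} R) (ModuleCat.{u} R)).obj Y)
    (Limits.colimit.isColimit (diagram (idealPowersDiagram J) i))

/-- The canonical map from `Ext (R ⧸ J ^ t) Y i` to local cohomology. -/
noncomputable def ofExt (t : ℕ) : Abelian.Ext (ModuleCat.of R (R ⧸ J ^ t)) Y i →ₗ[R]
    (localCohomology J i).obj Y :=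
  (((Limits.colimit.ι (diagram (idealPowersDiagram J) i)
      (Opposite.op (Opposite.op t))).app Y).hom) ∘ₗ
    (extComparison (ModuleCat.of R (R ⧸ J ^ t)) Y i).symm.toLinearMap

lemma ofExt_extComparison (t : ℕ)
    (α : ((Ext R (ModuleCat.{u} R) i).obj (Opposite.op (ModuleCat.of R (R ⧸ J ^ t)))).obj Y) :
    ofExt J i Y t (extComparison _ Y i α) =
      ((Limits.colimit.ι (diagram (idealPowersDiagram J) i)
        (Opposite.op (Opposite.op t))).app Y).hom α :=
  congr_arg ((Limits.colimit.ι (diagram (idealPowersDiagram J) i)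
        (Opposite.op (Opposite.op t))).app Y).hom (LinearEquiv.symm_apply_apply _ α)

instance preservesColimits_forget_opOp :
    Limits.PreservesColimitsOfShape ℕᵒᵖᵒᵖ (forget (ModuleCat.{u} R)) :=
  have := Limits.preservesFilteredColimitsOfSize_shrink.{0, u, 0, u} (forget (ModuleCat.{u} R))
  Limits.PreservesFilteredColimitsOfSize.preserves_filtered_colimits _

lemma ofExt_powProj {t s : ℕ} (h : t ≤ s) (α : Abelian.Ext (ModuleCat.of R (R ⧸ J ^ t)) Y i) :
    ofExt J i Y s ((Abelian.Ext.mk₀ (powProj J h)).comp α (zero_add i)) = ofExt J i Y t α := by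
  obtain ⟨α, rfl⟩ := (extComparison _ Y i).surjective α
  rw [← extComparison_naturality]
  rw [ofExt_extComparison, ofExt_extComparison]
  have h1 := Limits.colimit.w (diagram (idealPowersDiagram J) i)
    (homOfLE h).op.op
  exact congr_arg (fun k ↦ (k.app Y).hom α) h1

lemma exists_ofExt (x : (localCohomology J i).obj Y) : ∃ t α, ofExt J i Y t α = x := by
  obtain ⟨j, α, rfl⟩ := Limits.Concrete.isColimit_exists_rep _ (evalIsColimit J i Y) x
  exact ⟨j.unop.unop, extComparison _ Y i α, ofExt_extComparison J i Y _ α⟩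

lemma ofExt_eq_zero {t : ℕ} {α : Abelian.Ext (ModuleCat.of R (R ⧸ J ^ t)) Y i}
    (hα : ofExt J i Y t α = 0) :
    ∃ (s : ℕ) (h : t ≤ s), (Abelian.Ext.mk₀ (powProj J h)).comp α (zero_add i) = 0 := by
  obtain ⟨α, rfl⟩ := (extComparison _ Y i).surjective α
  rw [ofExt_extComparison] at hα
  obtain ⟨k, f, g, hfg⟩ := Limits.Concrete.isColimit_exists_of_rep_eq _ (evalIsColimit J i Y)
    (i := Opposite.op (Opposite.op t)) (j := Opposite.op (Opposite.op t)) α 0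
    (hα.trans (map_zero _).symm)
  refine ⟨k.unop.unop, leOfHom f.unop.unop, ?_⟩
  rw [← extComparison_naturality, map_eq_zero_iff _ (LinearEquiv.injective _)]
  exact hfg.trans (map_zero _)

end localCohomology

/-- Vanishing of `Ext_R^i(A, B)` for unbundled modules. -/
def ExtVanish (R : Type u) [CommRing R] (A B : Type u) [AddCommGroup A] [Module R A]
    [AddCommGroup B] [Module R B] (i : ℕ) : Prop :=
  Subsingleton (Abelian.Ext (ModuleCat.of R A) (ModuleCat.of R B) i)

namespace ExtVanish

variable {R : Type u} [CommRing R]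
variable {A B D X Y : Type u} [AddCommGroup A] [Module R A] [AddCommGroup B] [Module R B]
  [AddCommGroup D] [Module R D] [AddCommGroup X] [Module R X] [AddCommGroup Y] [Module R Y]

/-- A short complex of modules built from an exact pair of linear maps. -/
abbrev sc (f : A →ₗ[R] B) (g : B →ₗ[R] D) (h : Function.Exact f g) :
    ShortComplex (ModuleCat.{u} R) :=
  ShortComplex.mk (ModuleCat.ofHom f) (ModuleCat.ofHom g)
    (by ext x; exact h.apply_apply_eq_zero x)

lemma sc_shortExact {f : A →ₗ[R] B} {g : B →ₗ[R] D} (hf : Function.Injective f)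
    (h : Function.Exact f g) (hg : Function.Surjective g) : (sc f g h).ShortExact where
  exact := (ShortComplex.moduleCat_exact_iff _).2 fun x hx ↦ (h x).1 hx
  mono_f := (ModuleCat.mono_iff_injective _).2 hf
  epi_g := (ModuleCat.epi_iff_surjective _).2 hg

lemma subsingleton_iff {i : ℕ} :
    ExtVanish R A B i ↔ ∀ x : Abelian.Ext (ModuleCat.of R A) (ModuleCat.of R B) i, x = 0 :=
  ⟨fun h _ ↦ h.elim _ _, fun h ↦ ⟨fun x y ↦ (h x).trans (h y).symm⟩⟩

lemma of_projective [Module.Projective R A] {i : ℕ} (hi : 1 ≤ i) : ExtVanish R A B i := by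
  obtain ⟨i, rfl⟩ := Nat.exists_eq_add_of_le' hi
  exact Abelian.Ext.subsingleton_of_projective _ _ _

lemma of_injective [Module.Injective R B] {i : ℕ} (hi : 1 ≤ i) : ExtVanish R A B i := by
  obtain ⟨i, rfl⟩ := Nat.exists_eq_add_of_le' hi
  have := Module.injective_object_of_injective_module R B
  exact subsingleton_iff.2 fun x ↦ x.eq_zero_of_injective

lemma contra_mid {f : A →ₗ[R] B} {g : B →ₗ[R] D} (hf : Function.Injective f)
    (h : Function.Exact f g) (hg : Function.Surjective g)
    {i : ℕ} (h₁ : ExtVanish R A Y i) (h₃ : ExtVanish R D Y i) :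
    ExtVanish R B Y i := subsingleton_iff.2 fun x ↦ by
  obtain ⟨y, rfl⟩ := Abelian.Ext.contravariant_sequence_exact₂ (sc_shortExact hf h hg)
    (ModuleCat.of R Y) x (h₁.elim _ _)
  rw [h₃.elim y 0, Abelian.Ext.comp_zero]

lemma contra_right {f : A →ₗ[R] B} {g : B →ₗ[R] D} (hf : Function.Injective f)
    (h : Function.Exact f g) (hg : Function.Surjective g)
    {i : ℕ} (h₁ : ExtVanish R A Y i) (h₂ : ExtVanish R B Y (i + 1)) :
    ExtVanish R D Y (i + 1) := subsingleton_iff.2 fun x ↦ by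
  obtain ⟨y, rfl⟩ := Abelian.Ext.contravariant_sequence_exact₃ (sc_shortExact hf h hg)
    (ModuleCat.of R Y) x (h₂.elim _ _) (add_comm 1 i)
  rw [h₁.elim y 0, Abelian.Ext.comp_zero]

lemma contra_left {f : A →ₗ[R] B} {g : B →ₗ[R] D} (hf : Function.Injective f)
    (h : Function.Exact f g) (hg : Function.Surjective g)
    {i : ℕ} (h₂ : ExtVanish R B Y i) (h₃ : ExtVanish R D Y (i + 1)) :
    ExtVanish R A Y i := subsingleton_iff.2 fun x ↦ by
  obtain ⟨y, rfl⟩ := Abelian.Ext.contravariant_sequence_exact₁ (sc_shortExact hf h hg)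
    (ModuleCat.of R Y) x (add_comm 1 i) (h₃.elim _ _)
  rw [h₂.elim y 0, Abelian.Ext.comp_zero]

lemma co_mid {f : A →ₗ[R] B} {g : B →ₗ[R] D} (hf : Function.Injective f)
    (h : Function.Exact f g) (hg : Function.Surjective g)
    {i : ℕ} (h₁ : ExtVanish R X A i) (h₃ : ExtVanish R X D i) :
    ExtVanish R X B i := subsingleton_iff.2 fun x ↦ by
  obtain ⟨y, rfl⟩ := Abelian.Ext.covariant_sequence_exact₂ (ModuleCat.of R X)
    (sc_shortExact hf h hg) x (h₃.elim _ _)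
  rw [h₁.elim y 0, Abelian.Ext.zero_comp]

lemma co_left {f : A →ₗ[R] B} {g : B →ₗ[R] D} (hf : Function.Injective f)
    (h : Function.Exact f g) (hg : Function.Surjective g)
    {i : ℕ} (h₂ : ExtVanish R X B (i + 1)) (h₃ : ExtVanish R X D i) :
    ExtVanish R X A (i + 1) := subsingleton_iff.2 fun x ↦ by
  obtain ⟨y, rfl⟩ := Abelian.Ext.covariant_sequence_exact₁ (ModuleCat.of R X)
    (sc_shortExact hf h hg) x (h₂.elim _ _) rfl
  rw [h₃.elim y 0, Abelian.Ext.zero_comp]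

lemma co_right {f : A →ₗ[R] B} {g : B →ₗ[R] D} (hf : Function.Injective f)
    (h : Function.Exact f g) (hg : Function.Surjective g)
    {i : ℕ} (h₂ : ExtVanish R X B i) (h₁ : ExtVanish R X A (i + 1)) :
    ExtVanish R X D i := subsingleton_iff.2 fun x ↦ by
  obtain ⟨y, rfl⟩ := Abelian.Ext.covariant_sequence_exact₃ (ModuleCat.of R X)
    (sc_shortExact hf h hg) x rfl (h₁.elim _ _)
  rw [h₂.elim y 0, Abelian.Ext.zero_comp]

/-- If `Ext¹(X, A) = 0` then maps `X → D` lift to `B`. -/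
lemma exists_lift {f : A →ₗ[R] B} {g : B →ₗ[R] D} (hf : Function.Injective f)
    (h : Function.Exact f g) (hg : Function.Surjective g) (h₁ : ExtVanish R X A 1) (k : X →ₗ[R] D) :
    ∃ l : X →ₗ[R] B, g ∘ₗ l = k := by
  obtain ⟨y, hy⟩ := Abelian.Ext.covariant_sequence_exact₃ (ModuleCat.of R X)
    (sc_shortExact hf h hg) (.mk₀ (ModuleCat.ofHom k)) (zero_add 1) (h₁.elim _ _)
  obtain ⟨y, rfl⟩ := (Abelian.Ext.mk₀_bijective _ _).2 y
  rw [Abelian.Ext.mk₀_comp_mk₀] at hy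
  replace hy := (Abelian.Ext.mk₀_bijective _ _).1 hy
  exact ⟨y.hom, congr_arg ModuleCat.Hom.hom hy⟩

/-- If maps `X → D` lift to `B` and `Ext¹(X, B) = 0`, then `Ext¹(X, A) = 0`. -/
lemma of_exists_lift {f : A →ₗ[R] B} {g : B →ₗ[R] D} (hf : Function.Injective f)
    (h : Function.Exact f g) (hg : Function.Surjective g) (h₂ : ExtVanish R X B 1)
    (H : ∀ k : X →ₗ[R] D, ∃ l : X →ₗ[R] B, g ∘ₗ l = k) : ExtVanish R X A 1 :=
  subsingleton_iff.2 fun x ↦ by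
  obtain ⟨y, rfl⟩ := Abelian.Ext.covariant_sequence_exact₁ (ModuleCat.of R X)
    (sc_shortExact hf h hg) x (h₂.elim _ _) (zero_add 1)
  obtain ⟨y, rfl⟩ := (Abelian.Ext.mk₀_bijective _ _).2 y
  obtain ⟨l, hl⟩ := H y.hom
  have : y = ModuleCat.ofHom l ≫ (sc f g h).g := by
    ext x; exact (LinearMap.congr_fun hl x).symm
  rw [this, ← Abelian.Ext.mk₀_comp_mk₀]
  have := (sc_shortExact hf h hg).comp_extClass
  rw [Abelian.Ext.comp_assoc_of_second_deg_zero, this, Abelian.Ext.comp_zero]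

/-- If `Ext¹(D, Y) = 0` then maps `A → Y` extend to `B`. -/
lemma exists_extend {f : A →ₗ[R] B} {g : B →ₗ[R] D} (hf : Function.Injective f)
    (h : Function.Exact f g) (hg : Function.Surjective g) (h₃ : ExtVanish R D Y 1) (k : A →ₗ[R] Y) :
    ∃ l : B →ₗ[R] Y, l ∘ₗ f = k := by
  obtain ⟨y, hy⟩ := Abelian.Ext.contravariant_sequence_exact₁
    (sc_shortExact hf h hg) (ModuleCat.of R Y) (.mk₀ (ModuleCat.ofHom k)) (add_zero 1)
    (h₃.elim _ _)
  obtain ⟨y, rfl⟩ := (Abelian.Ext.mk₀_bijective _ _).2 y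
  rw [Abelian.Ext.mk₀_comp_mk₀] at hy
  replace hy := (Abelian.Ext.mk₀_bijective _ _).1 hy
  exact ⟨y.hom, congr_arg ModuleCat.Hom.hom hy⟩

/-- If maps `A → Y` extend to `B` and `Ext¹(B, Y) = 0`, then `Ext¹(D, Y) = 0`. -/
lemma of_exists_extend {f : A →ₗ[R] B} {g : B →ₗ[R] D} (hf : Function.Injective f)
    (h : Function.Exact f g) (hg : Function.Surjective g) (h₂ : ExtVanish R B Y 1)
    (H : ∀ k : A →ₗ[R] Y, ∃ l : B →ₗ[R] Y, l ∘ₗ f = k) : ExtVanish R D Y 1 :=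
  subsingleton_iff.2 fun x ↦ by
  obtain ⟨y, rfl⟩ := Abelian.Ext.contravariant_sequence_exact₃
    (sc_shortExact hf h hg) (ModuleCat.of R Y) x (h₂.elim _ _) (add_zero 1)
  obtain ⟨y, rfl⟩ := (Abelian.Ext.mk₀_bijective _ _).2 y
  obtain ⟨l, hl⟩ := H y.hom
  have : y = (sc f g h).f ≫ ModuleCat.ofHom l := by
    ext x; exact (LinearMap.congr_fun hl x).symm
  have h2 := (sc_shortExact hf h hg).extClass_comp
  rw [this, ← Abelian.Ext.mk₀_comp_mk₀,
    ← Abelian.Ext.comp_assoc _ _ _ (add_zero 1) (zero_add 0) (by omega), h2, Abelian.Ext.zero_comp]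

lemma zero_iff : ExtVanish R A B 0 ↔ ∀ l : A →ₗ[R] B, l = 0 := by
  rw [subsingleton_iff]
  constructor
  · intro H l
    have := H (.mk₀ (ModuleCat.ofHom l))
    rw [← Abelian.Ext.mk₀_zero] at this
    exact congr_arg ModuleCat.Hom.hom ((Abelian.Ext.mk₀_bijective _ _).1 this)
  · intro H x
    obtain ⟨y, rfl⟩ := (Abelian.Ext.mk₀_bijective _ _).2 x
    have : y = 0 := ModuleCat.hom_ext (H y.hom)
    rw [this, Abelian.Ext.mk₀_zero]

/-- Vanishing of `Ext` passes to retracts in the first variable. -/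
lemma retract_left {i : ℕ} (s : A →ₗ[R] B) (r : B →ₗ[R] A) (hrs : r ∘ₗ s = LinearMap.id)
    (H : ExtVanish R B Y i) : ExtVanish R A Y i := subsingleton_iff.2 fun x ↦ by
  have h1 : (Abelian.Ext.mk₀ (ModuleCat.ofHom s)).comp
      ((Abelian.Ext.mk₀ (ModuleCat.ofHom r)).comp x (zero_add i)) (zero_add i) = x := by
    rw [← Abelian.Ext.comp_assoc _ _ _ (zero_add 0) (zero_add i) (by omega),
      Abelian.Ext.mk₀_comp_mk₀, ← ModuleCat.ofHom_comp, hrs]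
    exact Abelian.Ext.mk₀_id_comp x
  rw [← h1, H.elim ((Abelian.Ext.mk₀ (ModuleCat.ofHom r)).comp x (zero_add i)) 0,
    Abelian.Ext.comp_zero]

/-- Vanishing of `Ext` passes to retracts in the second variable. -/
lemma retract_right {i : ℕ} (s : A →ₗ[R] B) (r : B →ₗ[R] A) (hrs : r ∘ₗ s = LinearMap.id)
    (H : ExtVanish R X B i) : ExtVanish R X A i := subsingleton_iff.2 fun x ↦ by
  have h1 : (x.comp (Abelian.Ext.mk₀ (ModuleCat.ofHom s)) (add_zero i)).comp
      (Abelian.Ext.mk₀ (ModuleCat.ofHom r)) (add_zero i) = x := by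
    rw [Abelian.Ext.comp_assoc_of_third_deg_zero, Abelian.Ext.mk₀_comp_mk₀,
      ← ModuleCat.ofHom_comp, hrs]
    exact Abelian.Ext.comp_mk₀_id x
  rw [← h1, H.elim (x.comp (Abelian.Ext.mk₀ (ModuleCat.ofHom s)) (add_zero i)) 0,
    Abelian.Ext.zero_comp]

lemma congr_left {i : ℕ} (e : A ≃ₗ[R] B) (H : ExtVanish R B Y i) : ExtVanish R A Y i :=
  retract_left e.toLinearMap e.symm.toLinearMap (by ext; simp) H

lemma congr_right {i : ℕ} (e : A ≃ₗ[R] B) (H : ExtVanish R X B i) : ExtVanish R X A i :=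
  retract_right e.toLinearMap e.symm.toLinearMap (by ext; simp) H

lemma of_subsingleton_left [Subsingleton A] {i : ℕ} : ExtVanish R A Y i := by
  refine retract_left (B := PUnit.{u+1}) 0 0 (by ext; exact Subsingleton.elim _ _) ?_
  rcases i with _ | i
  · exact zero_iff.2 fun l ↦ by ext; simpa using l.map_zero
  · exact of_projective (by omega)

lemma of_subsingleton_right [Subsingleton A] {i : ℕ} : ExtVanish R X A i := by
  refine subsingleton_iff.2 fun x ↦ ?_
  have h0 : (𝟙 (ModuleCat.of R A)) = 0 := by ext; exact Subsingleton.elim (α := A) _ _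
  rw [← Abelian.Ext.comp_mk₀_id x, h0, Abelian.Ext.mk₀_zero, Abelian.Ext.comp_zero]

/-- If multiplication by `r` kills `A` and is bijective on `B`, then `Ext(A, B) = 0`. -/
lemma of_smul_bijective (r : R) (hA : ∀ a : A, r • a = 0)
    (hB : Function.Bijective (fun b : B ↦ r • b)) (i : ℕ) : ExtVanish R A B i := by
  refine subsingleton_iff.2 fun x ↦ ?_
  let e : B ≃ₗ[R] B := LinearEquiv.ofBijective (LinearMap.lsmul R B r) hB
  have h1 : x.comp (Abelian.Ext.mk₀ (ModuleCat.ofHom e.toLinearMap)) (add_zero i) = 0 := by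
    have h2 : ModuleCat.ofHom e.toLinearMap = r • 𝟙 (ModuleCat.of R B) := by ext x; rfl
    have h3 : r • 𝟙 (ModuleCat.of R A) = 0 := by ext x; exact hA x
    rw [h2, Abelian.Ext.mk₀_smul, Abelian.Ext.comp_smul, Abelian.Ext.comp_mk₀_id]
    rw [← Abelian.Ext.mk₀_id_comp x, ← Abelian.Ext.smul_comp, ← Abelian.Ext.mk₀_smul, h3,
      Abelian.Ext.mk₀_zero, Abelian.Ext.zero_comp]
  have h4 : (x.comp (Abelian.Ext.mk₀ (ModuleCat.ofHom e.toLinearMap)) (add_zero i)).comp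
      (Abelian.Ext.mk₀ (ModuleCat.ofHom e.symm.toLinearMap)) (add_zero i) = x := by
    rw [Abelian.Ext.comp_assoc_of_third_deg_zero, Abelian.Ext.mk₀_comp_mk₀,
      ← ModuleCat.ofHom_comp]
    simp only [LinearEquiv.symm_comp]
    exact Abelian.Ext.comp_mk₀_id x
  rw [← h4, h1, Abelian.Ext.zero_comp]

end ExtVanish

section

namespace ExtVanish

variable {R : Type u} [CommRing R]
variable {A B D X Y : Type u} [AddCommGroup A] [Module R A] [AddCommGroup B] [Module R B]
  [AddCommGroup D] [Module R D] [AddCommGroup X] [Module R X] [AddCommGroup Y] [Module R Y]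

lemma smul_eq_comp_left {i : ℕ} (r : R)
    (x : Abelian.Ext (ModuleCat.of R A) (ModuleCat.of R B) i) :
    r • x = (Abelian.Ext.mk₀ (ModuleCat.ofHom (LinearMap.lsmul R A r))).comp x (zero_add i) := by
  have h2 : ModuleCat.ofHom (LinearMap.lsmul R A r) = r • 𝟙 (ModuleCat.of R A) := by
    ext x; rfl
  rw [h2, Abelian.Ext.mk₀_smul, Abelian.Ext.smul_comp, Abelian.Ext.mk₀_id_comp]

lemma smul_eq_comp_right {i : ℕ} (r : R)
    (x : Abelian.Ext (ModuleCat.of R A) (ModuleCat.of R B) i) :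
    r • x = x.comp (Abelian.Ext.mk₀ (ModuleCat.ofHom (LinearMap.lsmul R B r))) (add_zero i) := by
  have h2 : ModuleCat.ofHom (LinearMap.lsmul R B r) = r • 𝟙 (ModuleCat.of R B) := by
    ext x; rfl
  rw [h2, Abelian.Ext.mk₀_smul, Abelian.Ext.comp_smul, Abelian.Ext.comp_mk₀_id]

lemma smul_eq_zero_of_left {i : ℕ} {r : R} (hA : ∀ a : A, r • a = 0)
    (x : Abelian.Ext (ModuleCat.of R A) (ModuleCat.of R B) i) : r • x = 0 := by
  have : ModuleCat.ofHom (LinearMap.lsmul R A r) = 0 := by ext a; exact hA a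
  rw [smul_eq_comp_left, this, Abelian.Ext.mk₀_zero, Abelian.Ext.zero_comp]

lemma smul_shortExact {r : R} (hr : IsSMulRegular B r) :
    (sc (LinearMap.lsmul R B r) (Submodule.mkQ (r • (⊤ : Submodule R B)))
      (LinearMap.exact_lsmul_mkQ_smul_top B r)).ShortExact :=
  sc_shortExact (f := LinearMap.lsmul R B r) hr _ (Submodule.mkQ_surjective _)

lemma eq_zero_of_smul_eq_zero {i : ℕ} {r : R} (hr : IsSMulRegular B r)
    (h : ExtVanish R A (QuotSMulTop r B) i)
    {x : Abelian.Ext (ModuleCat.of R A) (ModuleCat.of R B) (i + 1)} (hx : r • x = 0) : x = 0 := by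
  rw [smul_eq_comp_right] at hx
  obtain ⟨y, rfl⟩ := Abelian.Ext.covariant_sequence_exact₁ (ModuleCat.of R A)
    (smul_shortExact hr) x hx rfl
  rw [Subsingleton.elim (h := h) y 0, Abelian.Ext.zero_comp]

/-- `Ext` out of a module that is torsion for the elements of a weakly regular sequence vanishes
below the length of the sequence. -/
lemma of_isWeaklyRegular (rs : List R) (hA : ∀ r ∈ rs, ∃ s : ℕ, ∀ a : A, r ^ s • a = 0) :
    ∀ (B : Type u) [AddCommGroup B] [Module R B], RingTheory.Sequence.IsWeaklyRegular B rs →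
    ∀ i < rs.length, ExtVanish R A B i := by
  induction rs with
  | nil => simp
  | cons r rs ih =>
    intro B _ _ hB i hi
    rw [RingTheory.Sequence.isWeaklyRegular_cons_iff] at hB
    obtain ⟨s, hs⟩ := hA r (by simp)
    rcases i with _ | i
    · refine zero_iff.2 fun l ↦ ?_
      ext a
      refine (hB.1.pow s) ?_
      simp only [LinearMap.zero_apply, smul_zero]
      rw [← map_smul, hs, map_zero]
    · have h1 := ih (fun r hr ↦ hA r (by simp [hr])) _ hB.2 i (by simpa using hi)
      refine subsingleton_iff.2 fun x ↦ ?_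
      have h2 : ∀ s : ℕ, r ^ s • x = 0 → x = 0 := by
        intro s
        induction s with
        | zero => simp
        | succ s ihs =>
          intro h
          rw [pow_succ', mul_smul] at h
          exact ihs (eq_zero_of_smul_eq_zero hB.1 h1 h)
      exact h2 s (smul_eq_zero_of_left hs x)

/-- Dévissage: vanishing of `Ext` for cyclic modules `R ⧸ p` implies it for finite modules. -/
lemma of_forall_prime [IsNoetherianRing R] [hA : Module.Finite R A] {i : ℕ}
    (H : ∀ p : PrimeSpectrum R, Module.annihilator R A ≤ p.asIdeal →
      ExtVanish R (R ⧸ p.asIdeal) Y i) : ExtVanish R A Y i := by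
  revert H
  induction hA using IsNoetherianRing.induction_on_isQuotientEquivQuotientPrime R with
  | subsingleton N => intro _; exact of_subsingleton_left
  | quotient N p e =>
    intro H
    refine congr_left e (H p ?_)
    rw [e.annihilator_eq, Ideal.annihilator_quotient]
  | exact N₁ N₂ N₃ f g hf hg h ih₁ ih₃ =>
    intro H
    refine contra_mid hf h hg (ih₁ fun p hp ↦ H p ?_) (ih₃ fun p hp ↦ H p ?_)
    · exact (LinearMap.annihilator_le_of_injective f hf).trans hp
    · exact (LinearMap.annihilator_le_of_surjective g hg).trans hp

lemma of_residueField [IsNoetherianRing R] [IsLocalRing R] [Module.Finite R A] {i s : ℕ}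
    (hs : ∀ r ∈ IsLocalRing.maximalIdeal R ^ s, ∀ a : A, r • a = 0)
    (H : ExtVanish R (R ⧸ IsLocalRing.maximalIdeal R) Y i) : ExtVanish R A Y i := by
  refine of_forall_prime fun p hp ↦ ?_
  have h1 : IsLocalRing.maximalIdeal R ^ s ≤ p.asIdeal :=
    le_trans (fun r hr ↦ Module.mem_annihilator.2 (hs r hr)) hp
  have h2 : IsLocalRing.maximalIdeal R ≤ p.asIdeal := p.isPrime.le_of_pow_le h1
  have h3 := (IsLocalRing.maximalIdeal.isMaximal R).eq_of_le p.isPrime.ne_top h2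
  rwa [← h3]

/-- A finite module `C` with `Ext^j(k, C) = 0` for large `j` satisfies `Ext^j(-, C) = 0` on
cyclic modules for large `j`. -/
lemma quotient_of_residueField [IsNoetherianRing R] [IsLocalRing R] [Module.Finite R Y] {N : ℕ}
    (H : ∀ j, N < j → ExtVanish R (R ⧸ IsLocalRing.maximalIdeal R) Y j) (a : Ideal R) :
    ∀ j, N < j → ExtVanish R (R ⧸ a) Y j := by
  induction a using IsNoetherian.induction with
  | _ a ih =>
  intro j hj
  by_cases ha : Ideal.IsPrime a
  · by_cases ham : a = IsLocalRing.maximalIdeal R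
    · rw [ham]; exact H j hj
    · obtain ⟨x, hx, hxa⟩ := Set.exists_of_ssubset
        (SetLike.coe_ssubset_coe.2 (lt_of_le_of_ne (IsLocalRing.le_maximalIdeal ha.ne_top) ham))
      have reg : IsSMulRegular (R ⧸ a) x := by
        rw [isSMulRegular_iff_right_eq_zero_of_smul]
        intro y hy
        obtain ⟨y, rfl⟩ := Ideal.Quotient.mk_surjective y
        rw [← Ideal.Quotient.mk_eq_mk, ← Submodule.Quotient.mk_smul,
          Submodule.Quotient.mk_eq_zero, smul_eq_mul] at hy
        exact Ideal.Quotient.eq_zero_iff_mem.2 ((ha.mem_or_mem hy).resolve_left hxa)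
      have h1 : ExtVanish R (QuotSMulTop x (R ⧸ a)) Y (j + 1) := by
        refine of_forall_prime fun p hp ↦ ih p.asIdeal ?_ _ (by omega)
        have h2 : a ≤ p.asIdeal := le_trans (fun r hr ↦ Module.mem_annihilator.2 fun y ↦ ?_) hp
        · refine lt_of_le_of_ne h2 fun h3 ↦ hxa ?_
          change x ∈ a
          rw [h3]
          refine hp (Module.mem_annihilator.2 fun y ↦ ?_)
          obtain ⟨y, rfl⟩ := Submodule.mkQ_surjective _ y
          rw [← map_smul]
          exact (Submodule.Quotient.mk_eq_zero _).2
            (Submodule.smul_mem_pointwise_smul y x ⊤ trivial)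
        · obtain ⟨y, rfl⟩ := Submodule.mkQ_surjective _ y
          obtain ⟨y, rfl⟩ := Submodule.mkQ_surjective _ y
          rw [← map_smul, ← map_smul]
          have : (Submodule.mkQ a) (r • y) = 0 :=
            (Submodule.Quotient.mk_eq_zero _).2 (Ideal.mul_mem_right _ a hr)
          rw [this, map_zero]
      refine subsingleton_iff.2 fun z ↦ ?_
      have hfin : Module.Finite R
        (Abelian.Ext (ModuleCat.of R (R ⧸ a)) (ModuleCat.of R Y) j) := inferInstance
      have htop : (⊤ : Submodule R (Abelian.Ext (ModuleCat.of R (R ⧸ a)) (ModuleCat.of R Y) j)) ≤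
          IsLocalRing.maximalIdeal R • ⊤ := by
        intro z _
        obtain ⟨y, hy⟩ := Abelian.Ext.contravariant_sequence_exact₁
          (smul_shortExact reg) (ModuleCat.of R Y) z (add_comm 1 j)
          (Subsingleton.elim (h := h1) _ _)
        replace hy : x • y = z := (smul_eq_comp_left x y).trans hy
        rw [← hy]
        exact Submodule.smul_mem_smul hx trivial
      have hbot := Submodule.eq_bot_of_le_smul_of_le_jacobson_bot (IsLocalRing.maximalIdeal R) ⊤
        hfin.fg_top htop (IsLocalRing.maximalIdeal_le_jacobson _)
      exact (Submodule.mem_bot R).1 (hbot ▸ trivial)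
  · by_cases hat : a = ⊤
    · have : Subsingleton (R ⧸ a) := Ideal.Quotient.subsingleton_iff.2 hat
      exact of_subsingleton_left
    · refine of_forall_prime fun p hp ↦ ih p.asIdeal ?_ j hj
      rw [Ideal.annihilator_quotient] at hp
      exact lt_of_le_of_ne hp fun h ↦ ha (h ▸ p.isPrime)

/-- Baer's criterion in terms of `Ext¹`. -/
lemma injective_of_ext_one (H : ∀ a : Ideal R, ExtVanish R (R ⧸ a) Y 1) :
    Module.Injective R Y := by
  refine Module.Baer.injective fun I g ↦ ?_
  obtain ⟨l, hl⟩ := exists_extend I.subtype_injective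
    (LinearMap.exact_subtype_mkQ I) I.mkQ_surjective (H I) g
  exact ⟨l, fun x hx ↦ LinearMap.congr_fun hl ⟨x, hx⟩⟩

end ExtVanish

lemma exists_injective_embedding (R : Type u) [CommRing R] (M : Type u) [AddCommGroup M]
    [Module R M] : ∃ (X : ModuleCat.{u} R) (f : M →ₗ[R] X), Module.Injective R X ∧
      Function.Injective f := by
  refine ⟨Injective.under (ModuleCat.of R M), (Injective.ι (ModuleCat.of R M)).hom,
    Module.injective_module_of_injective_object R _
      (inj := inferInstanceAs (Injective (Injective.under (ModuleCat.of R M)))), ?_⟩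
  exact (ModuleCat.mono_iff_injective _).1 inferInstance

lemma hasCoresDimLE_injective_of_ext {R : Type u} [CommRing R] (N : ℕ) :
    ∀ (M : ModuleCat.{u} R), (∀ a : Ideal R, ExtVanish R (R ⧸ a) M (N + 1)) →
    HasCoresDimLE R (fun N => Module.Injective R N) N M := by
  induction N with
  | zero => exact fun M H ↦ Or.inr (ExtVanish.injective_of_ext_one H)
  | succ N ih =>
    intro M H
    obtain ⟨X, f, hX, hf⟩ := exists_injective_embedding R M
    refine Or.inr ⟨X, f, hX, hf, ih _ fun a ↦ ?_⟩
    exact ExtVanish.co_right hf (LinearMap.exact_map_mkQ_range f) (Submodule.mkQ_surjective _)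
      (ExtVanish.of_injective (by omega)) (H a)

lemma ExtVanish.of_hasCoresDimLE_injective {R : Type u} [CommRing R] (N : ℕ) :
    ∀ (M : ModuleCat.{u} R), HasCoresDimLE R (fun N => Module.Injective R N) N M →
    ∀ (T : Type u) [AddCommGroup T] [Module R T] (i : ℕ), N < i → ExtVanish R T M i := by
  induction N with
  | zero =>
    rintro M (h | h) T _ _ i hi
    · exact of_subsingleton_right
    · exact of_injective (by omega)
  | succ N ih =>
    rintro M (h | ⟨X, f, hX, hf, h⟩) T _ _ i hi
    · exact of_subsingleton_right
    · obtain ⟨i, rfl⟩ := Nat.exists_eq_add_of_le' (show 1 ≤ i by omega)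
      exact co_left hf (LinearMap.exact_map_mkQ_range f) (Submodule.mkQ_surjective _)
        (of_injective (by omega)) (ih _ h T i (by omega))

end

section

variable {R : Type u} [CommRing R] [IsNoetherianRing R] [IsLocalRing R]

lemma ExtVanish.residueField_of_localCohomology {Y : ModuleCat.{u} R} {n : ℕ}
    (H : ∀ i < n, Subsingleton ((localCohomology (IsLocalRing.maximalIdeal R) i).obj Y)) :
    ∀ i < n, ExtVanish R (R ⧸ IsLocalRing.maximalIdeal R) Y i := by
  intro i
  induction i using Nat.strong_induction_on with
  | _ i ih =>
  intro hi
  set J := IsLocalRing.maximalIdeal R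
  have key : ∀ {t s : ℕ} (h : t ≤ s) (α : Abelian.Ext (ModuleCat.of R (R ⧸ J ^ t)) Y i),
      (Abelian.Ext.mk₀ (localCohomology.powProj J h)).comp α (zero_add i) = 0 → α = 0 := by
    intro t s h α hα
    have hsurj : Function.Surjective (localCohomology.powProj J h).hom := fun y ↦ by
      obtain ⟨y, rfl⟩ := Submodule.mkQ_surjective _ y
      exact ⟨Submodule.mkQ _ y, rfl⟩
    rcases i with _ | i
    · obtain ⟨φ, rfl⟩ := (Abelian.Ext.mk₀_bijective _ _).2 α
      rw [Abelian.Ext.mk₀_comp_mk₀, ← Abelian.Ext.mk₀_zero] at hα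
      replace hα := (Abelian.Ext.mk₀_bijective _ _).1 hα
      have : Epi (localCohomology.powProj J h) := (ModuleCat.epi_iff_surjective _).2 hsurj
      rw [(cancel_epi (localCohomology.powProj J h)).1 (hα.trans Limits.comp_zero.symm),
        Abelian.Ext.mk₀_zero]
    · have hK : ExtVanish R (LinearMap.ker (localCohomology.powProj J h).hom) Y i := by
        refine of_residueField (s := s) ?_ (ih i (by omega) (by omega))
        rintro r hr ⟨y, hy⟩
        obtain ⟨y, rfl⟩ := Submodule.mkQ_surjective _ y
        refine Subtype.ext ?_
        change (Submodule.mkQ _) (r • y) = _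
        exact (Submodule.Quotient.mk_eq_zero _).2 (Ideal.mul_mem_right _ _ hr)
      obtain ⟨y, rfl⟩ := Abelian.Ext.contravariant_sequence_exact₃
        (sc_shortExact (Submodule.subtype_injective _)
          (LinearMap.exact_subtype_ker_map (localCohomology.powProj J h).hom) hsurj)
        Y α hα (add_comm 1 i)
      rw [Subsingleton.elim (h := hK) y 0, Abelian.Ext.comp_zero]
  refine congr_left (Submodule.quotEquivOfEq J (J ^ 1) (pow_one J).symm)
    (subsingleton_iff.2 fun α ↦ ?_)
  have := H i hi
  obtain ⟨s, hs, h0⟩ := localCohomology.ofExt_eq_zero J i Y (t := 1) (α := α)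
    (Subsingleton.elim _ _)
  exact key hs α h0

lemma exists_isWeaklyRegular_of_ext (n : ℕ) : ∀ (M : Type u) [AddCommGroup M] [Module R M]
    [Module.Finite R M],
    (∀ i < n, ExtVanish R (R ⧸ IsLocalRing.maximalIdeal R) M i) →
    ∃ rs : List R, rs.length = n ∧ (∀ r ∈ rs, r ∈ IsLocalRing.maximalIdeal R) ∧
      RingTheory.Sequence.IsWeaklyRegular M rs := by
  induction n with
  | zero => exact fun M _ _ _ _ ↦ ⟨[], rfl, by simp, by simp⟩
  | succ n ih =>
    intro M _ _ _ H
    obtain ⟨r, hr, hreg⟩ := (IsSMulRegular.subsingleton_linearMap_iff (R := R) (M := M)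
      (N := R ⧸ IsLocalRing.maximalIdeal R)).1
      ⟨fun f g ↦ (ExtVanish.zero_iff.1 (H 0 (by omega)) f).trans
        (ExtVanish.zero_iff.1 (H 0 (by omega)) g).symm⟩
    rw [Ideal.annihilator_quotient] at hr
    obtain ⟨rs, h1, h2, h3⟩ := ih (QuotSMulTop r M) fun i hi ↦
      ExtVanish.co_right (f := LinearMap.lsmul R M r) hreg (LinearMap.exact_lsmul_mkQ_smul_top M r)
        (Submodule.mkQ_surjective _) (H i (by omega)) (H (i + 1) (by omega))
    exact ⟨r :: rs, by simp [h1], List.forall_mem_cons.2 ⟨hr, h2⟩,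
      (RingTheory.Sequence.isWeaklyRegular_cons_iff _ _ _).2 ⟨hreg, h3⟩⟩

lemma exists_pow_le_ofList {n : ℕ} (hdim : ringKrullDim R = (n : WithBot ℕ∞)) {rs : List R}
    (hlen : rs.length = n) (hmem : ∀ r ∈ rs, r ∈ IsLocalRing.maximalIdeal R)
    (hreg : RingTheory.Sequence.IsWeaklyRegular R rs) :
    ∃ t : ℕ, IsLocalRing.maximalIdeal R ^ t ≤ Ideal.ofList rs := by
  have hle : Ideal.ofList rs ≤ IsLocalRing.maximalIdeal R := Ideal.span_le.2 hmem
  have hr : RingTheory.Sequence.IsRegular R rs := ⟨hreg, fun h ↦ by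
    have h1 : Ideal.ofList rs • (⊤ : Submodule R R) = Ideal.ofList rs := by simp
    rw [h1] at h
    exact (IsLocalRing.maximalIdeal.isMaximal R).ne_top (top_le_iff.1 (h.trans_le hle))⟩
  have h0 := ringKrullDim_add_length_eq_ringKrullDim_of_isRegular rs hr
  rw [hlen, hdim] at h0
  have h1 : ringKrullDim (R ⧸ Ideal.ofList rs) ≤ 0 := by
    generalize ringKrullDim (R ⧸ Ideal.ofList rs) = d at h0
    induction d with
    | bot => simp
    | coe d =>
      have h2 : d + n = n := by exact_mod_cast h0
      have : d = 0 := by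
        have h3 : d + (n : ℕ∞) = 0 + n := by rw [h2, zero_add]
        exact (ENat.add_left_injective_of_ne_top (ENat.natCast_ne_top n)) h3
      simp [this]
  have : Ring.KrullDimLE 0 (R ⧸ Ideal.ofList rs) := (Order.krullDimLE_iff _ _).2 h1
  refine Ideal.exists_pow_le_of_le_radical_of_fg ?_ (IsNoetherian.noetherian _)
  rw [Ideal.radical_eq_sInf]
  refine le_sInf fun p hp ↦ ?_
  obtain ⟨hp1, hp2⟩ := hp
  have hpm : (p.map (Ideal.Quotient.mk (Ideal.ofList rs))).IsPrime :=
    Ideal.map_isPrime_of_surjective Ideal.Quotient.mk_surjective (by simpa using hp1)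
  have hmax : (p.map (Ideal.Quotient.mk (Ideal.ofList rs))).IsMaximal :=
    Ideal.IsPrime.isMaximal' hpm
  have hpmax : p.IsMaximal := by
    have := Ideal.comap_isMaximal_of_surjective (Ideal.Quotient.mk (Ideal.ofList rs))
      Ideal.Quotient.mk_surjective (K := p.map (Ideal.Quotient.mk (Ideal.ofList rs)))
    rwa [Ideal.comap_map_of_surjective _ Ideal.Quotient.mk_surjective, ← RingHom.ker_eq_comap_bot,
      Ideal.mk_ker, sup_of_le_left hp1] at this
  exact (IsLocalRing.eq_maximalIdeal hpmax).ge

end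

section

variable {R : Type u} [CommRing R]
variable {A B D X Y : Type u} [AddCommGroup A] [Module R A] [AddCommGroup B] [Module R B]
  [AddCommGroup D] [Module R D] [AddCommGroup X] [Module R X] [AddCommGroup Y] [Module R Y]

/-- Every element of `rs` acts nilpotently on `T`. -/
def TorsBy (rs : List R) (T : Type u) [AddCommGroup T] [Module R T] : Prop :=
  ∀ r ∈ rs, ∃ s : ℕ, ∀ t : T, r ^ s • t = 0

/-- Composition with `e ∈ Ext^j(A, B)` shifts `Ext` bijectively on modules torsion for `rs`. -/
def IsExtShift (rs : List R) {j : ℕ}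
    (e : Abelian.Ext (ModuleCat.of R A) (ModuleCat.of R B) j) : Prop :=
  ∀ (T : Type u) [AddCommGroup T] [Module R T], TorsBy rs T → ∀ (i n : ℕ) (h : i + j = n),
    Function.Bijective fun φ : Abelian.Ext (ModuleCat.of R T) (ModuleCat.of R A) i ↦ φ.comp e h

lemma IsExtShift.extVanish {rs : List R} {j : ℕ}
    {e : Abelian.Ext (ModuleCat.of R A) (ModuleCat.of R B) j} (he : IsExtShift rs e)
    {T : Type u} [AddCommGroup T] [Module R T] (hT : TorsBy rs T) {i n : ℕ} (h : i + j = n) :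
    ExtVanish R T A i ↔ ExtVanish R T B n :=
  (Equiv.ofBijective _ (he T hT i n h)).subsingleton_congr

lemma isExtShift_equiv (f : A ≃ₗ[R] B) :
    IsExtShift ([] : List R) (Abelian.Ext.mk₀ (ModuleCat.ofHom f.toLinearMap)) := by
  rintro T _ _ - i n h
  obtain rfl : i = n := by omega
  refine Function.bijective_iff_has_inverse.2
    ⟨fun φ ↦ φ.comp (Abelian.Ext.mk₀ (ModuleCat.ofHom f.symm.toLinearMap)) h,
      fun φ ↦ ?_, fun φ ↦ ?_⟩
  · dsimp only
    rw [Abelian.Ext.comp_assoc_of_third_deg_zero, Abelian.Ext.mk₀_comp_mk₀,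
      ← ModuleCat.ofHom_comp, LinearEquiv.symm_comp]
    exact Abelian.Ext.comp_mk₀_id φ
  · dsimp only
    rw [Abelian.Ext.comp_assoc_of_third_deg_zero, Abelian.Ext.mk₀_comp_mk₀,
      ← ModuleCat.ofHom_comp, LinearEquiv.comp_symm]
    exact Abelian.Ext.comp_mk₀_id φ

lemma IsExtShift.snoc {rs : List R} {j : ℕ}
    {e : Abelian.Ext (ModuleCat.of R A) (ModuleCat.of R Y) j} (he : IsExtShift rs e) {x : R}
    {f : A →ₗ[R] B} {g : B →ₗ[R] D} (hf : Function.Injective f) (h : Function.Exact f g)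
    (hg : Function.Surjective g) (hx : Function.Bijective (fun b : B ↦ x • b)) :
    IsExtShift (rs ++ [x]) ((ExtVanish.sc_shortExact hf h hg).extClass.comp e (add_comm 1 j)) := by
  intro T _ _ hT i n hn
  obtain ⟨s, hs⟩ := hT x (by simp)
  have hB : ∀ i, ExtVanish R T B i := by
    refine ExtVanish.of_smul_bijective (x ^ s) hs ?_
    have : (fun b : B ↦ x ^ s • b) = (fun b : B ↦ x • b)^[s] := by
      ext b; rw [smul_iterate]
    rw [this]; exact hx.iterate s
  have h1 : Function.Bijective fun φ : Abelian.Ext (ModuleCat.of R T) (ModuleCat.of R D) i ↦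
      φ.comp (ExtVanish.sc_shortExact hf h hg).extClass (rfl : i + 1 = i + 1) := by
    let ψ := (ExtVanish.sc_shortExact hf h hg).extClass.postcomp (ModuleCat.of R T)
      (rfl : i + 1 = i + 1)
    refine ⟨(injective_iff_map_eq_zero ψ).2 fun φ hφ ↦ ?_, fun y ↦ ?_⟩
    · obtain ⟨z, rfl⟩ := Abelian.Ext.covariant_sequence_exact₃ (ModuleCat.of R T)
        (ExtVanish.sc_shortExact hf h hg) φ rfl hφ
      rw [Subsingleton.elim (h := hB i) z 0, Abelian.Ext.zero_comp]
    · exact Abelian.Ext.covariant_sequence_exact₁ (ModuleCat.of R T)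
        (ExtVanish.sc_shortExact hf h hg) y (Subsingleton.elim (h := hB _) _ _) rfl
  have h2 := he T (fun r hr ↦ hT r (by simp [hr])) (i + 1) n (by omega)
  convert h2.comp h1 using 1
  ext φ : 1
  exact (Abelian.Ext.comp_assoc φ _ e rfl (add_comm 1 j) (by omega)).symm

/-- `g : A → B` is an embedding of `A` into its localization away from `x`. -/
structure IsAwayEmbedding (x : R) (g : A →ₗ[R] B) : Prop where
  inj : Function.Injective g
  bij : Function.Bijective (fun b : B ↦ x • b)
  surj : ∀ b : B, ∃ (s : ℕ) (a : A), x ^ s • b = g a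

lemma IsAwayEmbedding.of_isLocalizedModule {x : R} (hx : IsSMulRegular A x) (g : A →ₗ[R] B)
    [IsLocalizedModule (Submonoid.powers x) g] : IsAwayEmbedding x g where
  inj := by
    refine (injective_iff_map_eq_zero g).2 fun a ha ↦ ?_
    obtain ⟨⟨_, s, rfl⟩, hs⟩ := (IsLocalizedModule.eq_zero_iff (Submonoid.powers x) g).1 ha
    refine (hx.pow s) ?_
    change x ^ s • a = x ^ s • 0
    rw [smul_zero]
    exact hs
  bij := (Module.End.isUnit_iff _).1
    (IsLocalizedModule.map_units g (⟨x, 1, pow_one x⟩ : Submonoid.powers x))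
  surj b := by
    obtain ⟨⟨a, ⟨_, s, rfl⟩⟩, h⟩ := IsLocalizedModule.surj (Submonoid.powers x) g b
    exact ⟨s, a, h⟩

lemma IsAwayEmbedding.bij_pow {x : R} {g : A →ₗ[R] B} (h : IsAwayEmbedding x g) (s : ℕ) :
    Function.Bijective (fun b : B ↦ x ^ s • b) := by
  have : (fun b : B ↦ x ^ s • b) = (fun b : B ↦ x • b)^[s] := by
    ext b; rw [smul_iterate]
  rw [this]; exact h.bij.iterate s

/-- Denominators can be cleared for maps out of a finite module. -/
lemma IsAwayEmbedding.exists_comp_eq {x : R} {g : A →ₗ[R] B} (h : IsAwayEmbedding x g)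
    [Module.Finite R X] (φ : X →ₗ[R] B) : ∃ (s : ℕ) (ψ : X →ₗ[R] A), g ∘ₗ ψ = x ^ s • φ := by
  suffices H : ∃ s : ℕ, ∀ c, x ^ s • φ c ∈ LinearMap.range g by
    obtain ⟨s, hs⟩ := H
    let e := LinearEquiv.ofInjective g h.inj
    refine ⟨s, e.symm.toLinearMap ∘ₗ LinearMap.codRestrict (LinearMap.range g) (x ^ s • φ) hs, ?_⟩
    ext c
    have := e.apply_symm_apply (LinearMap.codRestrict (LinearMap.range g) (x ^ s • φ) hs c)
    exact congr_arg Subtype.val this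
  obtain ⟨S, hS⟩ := (Module.Finite.fg_top : (⊤ : Submodule R X).FG)
  choose s a hsa using fun c ↦ h.surj (φ c)
  refine ⟨S.sup s, fun c ↦ ?_⟩
  have hc : c ∈ Submodule.span R (S : Set X) := hS ▸ trivial
  induction hc using Submodule.span_induction with
  | mem c hc =>
    have := Finset.le_sup (f := s) hc
    obtain ⟨k, hk⟩ := Nat.exists_eq_add_of_le' this
    rw [hk, pow_add, mul_smul, hsa, ← map_smul]
    exact ⟨_, rfl⟩
  | zero => simp
  | add a b _ _ ha hb => rw [map_add, smul_add]; exact add_mem ha hb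
  | smul r a _ ha => rw [map_smul, smul_comm]; exact Submodule.smul_mem _ _ ha

/-- Vanishing of `Ext` out of a finite module passes to localizations. -/
lemma IsAwayEmbedding.extVanish [IsNoetherianRing R] {x : R} {g : A →ₗ[R] B}
    (h : IsAwayEmbedding x g) {i : ℕ} [Module.Finite R X] (hX : ExtVanish R X A i) :
    ExtVanish R X B i := by
  have key : ∀ (X : Type u) [AddCommGroup X] [Module R X] [Module.Finite R X]
      (α : Abelian.Ext (ModuleCat.of R X) (ModuleCat.of R B) i),
      ∃ (s : ℕ) (β : Abelian.Ext (ModuleCat.of R X) (ModuleCat.of R A) i),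
        x ^ s • α = β.comp (Abelian.Ext.mk₀ (ModuleCat.ofHom g)) (add_zero i) := by
    clear hX
    induction i with
    | zero =>
      intro X _ _ _ α
      obtain ⟨φ, rfl⟩ := (Abelian.Ext.mk₀_bijective _ _).2 α
      obtain ⟨s, ψ, hψ⟩ := h.exists_comp_eq φ.hom
      refine ⟨s, Abelian.Ext.mk₀ (ModuleCat.ofHom ψ), ?_⟩
      rw [Abelian.Ext.mk₀_comp_mk₀, ← Abelian.Ext.mk₀_smul, ← ModuleCat.ofHom_comp, hψ]
      rfl
    | succ i ih =>
      intro X _ _ _ α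
      obtain ⟨n, p, hp⟩ := Module.Finite.exists_fin' R X
      let q : (ULift.{u} (Fin n) → R) →ₗ[R] X :=
        p ∘ₗ (LinearEquiv.funCongrLeft R R Equiv.ulift.symm).toLinearMap
      have hq : Function.Surjective q := hp.comp (LinearEquiv.surjective _)
      have hS := ExtVanish.sc_shortExact (Submodule.subtype_injective _)
        (LinearMap.exact_subtype_ker_map q) hq
      obtain ⟨β, rfl⟩ := Abelian.Ext.contravariant_sequence_exact₃ hS (ModuleCat.of R B) α
        (Subsingleton.elim (h := ExtVanish.of_projective (by omega)) _ _) (add_comm 1 i)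
      obtain ⟨s, γ, hγ⟩ := ih (LinearMap.ker q) β
      refine ⟨s, hS.extClass.comp γ (add_comm 1 i), ?_⟩
      rw [← Abelian.Ext.comp_smul, hγ, Abelian.Ext.comp_assoc_of_third_deg_zero]
  refine ExtVanish.subsingleton_iff.2 fun α ↦ ?_
  obtain ⟨s, β, hβ⟩ := key X α
  rw [Subsingleton.elim (h := hX) β 0, Abelian.Ext.zero_comp] at hβ
  let e : B ≃ₗ[R] B := LinearEquiv.ofBijective (LinearMap.lsmul R B (x ^ s)) (h.bij_pow s)
  have h4 : (x ^ s • α).comp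
      (Abelian.Ext.mk₀ (ModuleCat.ofHom e.symm.toLinearMap)) (add_zero i) = α := by
    rw [ExtVanish.smul_eq_comp_right, Abelian.Ext.comp_assoc_of_third_deg_zero,
      Abelian.Ext.mk₀_comp_mk₀, ← ModuleCat.ofHom_comp]
    have : e.symm.toLinearMap ∘ₗ LinearMap.lsmul R B (x ^ s) = LinearMap.id :=
      LinearEquiv.symm_comp e
    rw [this]
    exact Abelian.Ext.comp_mk₀_id α
  rw [← h4, hβ, Abelian.Ext.zero_comp]

/-- A module receiving no nonzero map from a faithful finite module is zero. -/
lemma subsingleton_of_hom_eq_zero [IsNoetherianRing R] [Module.Finite R X]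
    (hX : Module.annihilator R X = ⊥) (H : ∀ f : X →ₗ[R] Y, f = 0) : Subsingleton Y := by
  refine subsingleton_of_forall_eq 0 fun y ↦ ?_
  have h1 : Subsingleton (X →ₗ[R] Submodule.span R {y}) := ⟨fun f g ↦ by
    refine LinearMap.ext fun c ↦ Subtype.ext ?_
    have h1 := LinearMap.congr_fun (H ((Submodule.subtype _).comp f)) c
    have h2 := LinearMap.congr_fun (H ((Submodule.subtype _).comp g)) c
    exact h1.trans h2.symm⟩
  obtain ⟨r, hr, hreg⟩ := IsSMulRegular.subsingleton_linearMap_iff.1 h1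
  rw [hX, Submodule.mem_bot] at hr
  subst hr
  have := hreg (show (0 : R) • (⟨y, Submodule.mem_span_singleton_self y⟩ : Submodule.span R {y})
    = (0 : R) • 0 by simp)
  exact congr_arg Subtype.val this

/-- A countable direct sum of copies of `A` inherits vanishing of `Ext` in positive degrees. -/
lemma ExtVanish.finsupp (i : ℕ) : ∀ (Y : Type u) [AddCommGroup Y] [Module R Y],
    ExtVanish R A Y (i + 1) → ExtVanish R (ℕ →₀ A) Y (i + 1) := by
  induction i with
  | zero =>
    intro Y _ _ H
    obtain ⟨I, f, hI, hf⟩ := exists_injective_embedding R Y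
    refine of_exists_lift hf (LinearMap.exact_map_mkQ_range f) (Submodule.mkQ_surjective _)
      (of_injective le_rfl) fun k ↦ ?_
    choose l hl using fun n ↦ exists_lift hf (LinearMap.exact_map_mkQ_range f)
      (Submodule.mkQ_surjective _) H (k ∘ₗ Finsupp.lsingle n)
    refine ⟨Finsupp.lsum R l, Finsupp.lhom_ext' fun n ↦ ?_⟩
    rw [← hl n]
    ext a
    simp
  | succ i ih =>
    intro Y _ _ H
    obtain ⟨I, f, hI, hf⟩ := exists_injective_embedding R Y
    refine co_left hf (LinearMap.exact_map_mkQ_range f) (Submodule.mkQ_surjective _)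
      (of_injective (by omega)) (ih _ ?_)
    exact co_right hf (LinearMap.exact_map_mkQ_range f) (Submodule.mkQ_surjective _)
      (of_injective (by omega)) H

end

section

variable {R : Type u} [CommRing R]
variable {A B : Type u} [AddCommGroup A] [Module R A] [AddCommGroup B] [Module R B]

variable (A) in
/-- The map `single n a ↦ single n a - single (n + 1) (x • a)`, whose cokernel is the localization
of `A` away from `x`. -/
noncomputable def telescope (x : R) : (ℕ →₀ A) →ₗ[R] (ℕ →₀ A) :=
  LinearMap.id - (Finsupp.lmapDomain A R Nat.succ) ∘ₗ
    (Finsupp.mapRange.linearMap (LinearMap.lsmul R A x))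

@[simp]
lemma telescope_single (x : R) (n : ℕ) (a : A) :
    telescope A x (Finsupp.single n a) = Finsupp.single n a - Finsupp.single (n + 1) (x • a) := by
  simp [telescope, Finsupp.mapDomain_single]

lemma telescope_apply_zero (x : R) (v : ℕ →₀ A) : telescope A x v 0 = v 0 := by
  have : (Finsupp.mapDomain Nat.succ (Finsupp.mapRange.linearMap (LinearMap.lsmul R A x) v)) 0
      = 0 := Finsupp.mapDomain_of_notMem_range _ _ (by simp)
  simp only [telescope, LinearMap.sub_apply, LinearMap.id_apply, LinearMap.comp_apply,
    Finsupp.lmapDomain_apply, Finsupp.sub_apply, this, sub_zero]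

lemma telescope_apply_succ (x : R) (v : ℕ →₀ A) (n : ℕ) :
    telescope A x v (n + 1) = v (n + 1) - x • v n := by
  have : (Finsupp.mapDomain Nat.succ (Finsupp.mapRange.linearMap (LinearMap.lsmul R A x) v))
      (n + 1) = x • v n :=
    (Finsupp.mapDomain_apply Nat.succ_injective _ n)
  simp only [telescope, LinearMap.sub_apply, LinearMap.id_apply, LinearMap.comp_apply,
    Finsupp.lmapDomain_apply, Finsupp.sub_apply, this]

lemma telescope_injective (x : R) : Function.Injective (telescope A x) := by
  refine (injective_iff_map_eq_zero _).2 fun v hv ↦ ?_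
  ext n
  induction n with
  | zero => rw [← telescope_apply_zero x, hv]
  | succ n ih =>
    have := telescope_apply_succ x v n
    rw [hv, ih] at this
    simpa using this.symm

namespace IsAwayEmbedding

variable {x : R} {g : A →ₗ[R] B} (h : IsAwayEmbedding x g)

/-- Multiplication by `x ^ n` on a localization away from `x`. -/
noncomputable def powEquiv (n : ℕ) : B ≃ₗ[R] B :=
  LinearEquiv.ofBijective (LinearMap.lsmul R B (x ^ n)) (h.bij_pow n)

/-- The projection of the telescope onto the localization. -/
noncomputable def telescopeProj : (ℕ →₀ A) →ₗ[R] B :=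
  Finsupp.lsum R fun n ↦ (h.powEquiv n).symm.toLinearMap ∘ₗ g

lemma pow_smul_telescopeProj (n : ℕ) (a : A) :
    x ^ n • h.telescopeProj (Finsupp.single n a) = g a := by
  have : h.telescopeProj (Finsupp.single n a) = (h.powEquiv n).symm (g a) := by
    simp [telescopeProj]
  rw [this]
  exact (h.powEquiv n).apply_symm_apply (g a)

lemma telescopeProj_surjective : Function.Surjective h.telescopeProj := fun b ↦ by
  obtain ⟨s, a, ha⟩ := h.surj b
  refine ⟨Finsupp.single s a, (h.bij_pow s).1 ?_⟩
  exact (h.pow_smul_telescopeProj s a).trans ha.symm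

lemma telescopeProj_comp : h.telescopeProj ∘ₗ telescope A x = 0 := by
  refine Finsupp.lhom_ext' fun n ↦ LinearMap.ext fun a ↦ (h.bij_pow (n + 1)).1 ?_
  simp only [LinearMap.comp_apply, Finsupp.lsingle_apply, telescope_single, map_sub, smul_sub,
    LinearMap.zero_apply, smul_zero]
  rw [h.pow_smul_telescopeProj, pow_succ', mul_smul, h.pow_smul_telescopeProj, map_smul, sub_self]

lemma telescope_exact : Function.Exact (telescope A x) h.telescopeProj := by
  have shift : ∀ (k n : ℕ) (a : A), Finsupp.single n a - Finsupp.single (n + k) (x ^ k • a) ∈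
      LinearMap.range (telescope A x) := by
    intro k n a
    induction k with
    | zero => simp
    | succ k ih =>
      have := add_mem ih (LinearMap.mem_range_self (telescope A x)
        (Finsupp.single (n + k) (x ^ k • a)))
      rw [telescope_single, sub_add_sub_cancel, ← mul_smul, ← pow_succ', add_assoc] at this
      exact this
  have key : ∀ v : ℕ →₀ A, ∃ n a, v - Finsupp.single n a ∈ LinearMap.range (telescope A x) := by
    intro v
    induction v using Finsupp.induction_linear with
    | zero => exact ⟨0, 0, by simp⟩
    | single n a => exact ⟨n, a, by simp⟩
    | add v w hv hw =>
      obtain ⟨n, a, ha⟩ := hv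
      obtain ⟨m, b, hb⟩ := hw
      refine ⟨n + m, x ^ m • a + x ^ n • b, ?_⟩
      have h1 := add_mem ha (shift m n a)
      have h2 := add_mem hb (shift n m b)
      rw [sub_add_sub_cancel] at h1 h2
      rw [add_comm m n] at h2
      have := add_mem h1 h2
      rwa [sub_add_sub_comm, ← Finsupp.single_add] at this
  intro v
  constructor
  · intro hv
    obtain ⟨n, a, w, hw⟩ := key v
    have h0 : h.telescopeProj (Finsupp.single n a) = 0 := by
      have := LinearMap.congr_fun h.telescopeProj_comp w
      rw [LinearMap.comp_apply, hw, map_sub, hv, zero_sub] at this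
      simpa using this
    have ha : a = 0 := h.inj (by
      rw [← h.pow_smul_telescopeProj n a, h0, smul_zero, map_zero])
    rw [ha, Finsupp.single_zero, sub_zero] at hw
    exact ⟨w, hw⟩
  · rintro ⟨w, rfl⟩
    exact LinearMap.congr_fun h.telescopeProj_comp w

/-- `Ext` of a localization vanishes one degree higher. -/
lemma extVanish_left (h : IsAwayEmbedding x g) {Y : Type u} [AddCommGroup Y] [Module R Y]
    {i : ℕ}
    (h₁ : ExtVanish R A Y (i + 1)) (h₂ : ExtVanish R A Y (i + 2)) : ExtVanish R B Y (i + 2) :=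
  ExtVanish.contra_right (telescope_injective x) h.telescope_exact h.telescopeProj_surjective
    (ExtVanish.finsupp i Y h₁) (ExtVanish.finsupp (i + 1) Y h₂)

lemma extVanish_left_one (h : IsAwayEmbedding x g) {Y : Type u} [AddCommGroup Y] [Module R Y]
    (h₁ : ExtVanish R A Y 1) (H : ∀ k : A →ₗ[R] Y, ∃ l : A →ₗ[R] Y, x • l = k) :
    ExtVanish R B Y 1 := by
  refine ExtVanish.of_exists_extend (telescope_injective x) h.telescope_exact
    h.telescopeProj_surjective (ExtVanish.finsupp 0 Y h₁) fun k ↦ ?_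
  choose d hd using H
  let l : ℕ → (A →ₗ[R] Y) := fun n ↦
    Nat.rec 0 (fun n ln ↦ d (ln - k ∘ₗ Finsupp.lsingle n)) n
  have hl : ∀ n, x • l (n + 1) = l n - k ∘ₗ Finsupp.lsingle n := fun n ↦ hd _
  refine ⟨Finsupp.lsum R l, Finsupp.lhom_ext' fun n ↦ LinearMap.ext fun a ↦ ?_⟩
  have := LinearMap.congr_fun (hl n) a
  simp only [LinearMap.smul_apply, LinearMap.sub_apply, LinearMap.comp_apply,
    Finsupp.lsingle_apply] at this
  have hs : ∀ n a, Finsupp.lsum R l (Finsupp.single n a) = l n a := fun n a ↦ by simp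
  simp only [LinearMap.comp_apply, Finsupp.lsingle_apply, telescope_single, map_sub, hs]
  rw [map_smul, this, sub_sub_cancel]

end IsAwayEmbedding

variable {C I : Type u} [AddCommGroup C] [Module R C] [AddCommGroup I] [Module R I]

lemma exists_extend_of_rTensor_injective [Module.Injective R I] {f : A →ₗ[R] B}
    (hf : Function.Injective (f.rTensor C)) (k : A →ₗ[R] (C →ₗ[R] I)) :
    ∃ l : B →ₗ[R] (C →ₗ[R] I), l ∘ₗ f = k := by
  obtain ⟨l, hl⟩ := Module.Injective.out (f.rTensor C) hf (TensorProduct.lift k)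
  refine ⟨TensorProduct.curry l, ?_⟩
  ext a c
  exact hl (a ⊗ₜ c)

lemma rTensor_injective_of_exists_extend {f : A →ₗ[R] B}
    (H : ∀ (I : Type u) [AddCommGroup I] [Module R I], Module.Injective R I →
      ∀ k : A →ₗ[R] (C →ₗ[R] I), ∃ l : B →ₗ[R] (C →ₗ[R] I), l ∘ₗ f = k) :
    Function.Injective (f.rTensor C) := by
  obtain ⟨I, j, hI, hj⟩ := exists_injective_embedding R (A ⊗[R] C)
  obtain ⟨l, hl⟩ := H I hI (TensorProduct.curry j)
  have : TensorProduct.lift l ∘ₗ f.rTensor C = j := by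
    ext a c
    exact LinearMap.congr_fun (LinearMap.congr_fun hl a) c
  refine Function.Injective.of_comp (f := TensorProduct.lift l) ?_
  rw [← LinearMap.coe_comp, this]
  exact hj

end

section

variable {R : Type u} [CommRing R]
variable {A B D : Type u} [AddCommGroup A] [Module R A] [AddCommGroup B] [Module R B]
  [AddCommGroup D] [Module R D] {C : Type u} [AddCommGroup C] [Module R C]

/-- The properties of the iterated cokernels `D` of localizations along a regular sequence `rs`
which relate `D` and `D ⊗ C` to `R` and `C`. -/
structure IsChainModule (C : Type u) [AddCommGroup C] [Module R C] (rs : List R)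
    (D : Type u) [AddCommGroup D] [Module R D] : Prop where
  ext_tensor : ∀ i, 1 ≤ i → ExtVanish R C (D ⊗[R] C) i
  unit_bijective : Function.Bijective (TensorProduct.mk R D C)
  ext_hom : ∀ (I : Type u) [AddCommGroup I] [Module R I], Module.Injective R I →
    ∀ i, 1 ≤ i → ExtVanish R D (C →ₗ[R] I) i
  ext_length : ∀ (Y : Type u) [AddCommGroup Y] [Module R Y] (i : ℕ), rs.length < i →
    ExtVanish R D Y i
  shift : ∃ e : Abelian.Ext (ModuleCat.of R D) (ModuleCat.of R R) rs.length, IsExtShift rs e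
  shift_tensor : ∃ e : Abelian.Ext (ModuleCat.of R (D ⊗[R] C)) (ModuleCat.of R C) rs.length,
    IsExtShift rs e
  tors : ∀ r ∈ rs, ∀ d : D, ∃ s : ℕ, r ^ s • d = 0

lemma isChainModule_nil (hbij : Function.Bijective (LinearMap.lsmul R C))
    (hext : ∀ i, 1 ≤ i → ExtVanish R C C i) : IsChainModule C ([] : List R) R where
  ext_tensor i hi := ExtVanish.congr_right (TensorProduct.lid R C) (hext i hi)
  unit_bijective := by
    have h1 : (fun f : C →ₗ[R] C ↦ (TensorProduct.lid R C).symm.toLinearMap ∘ₗ f) ∘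
        (LinearMap.lsmul R C) = TensorProduct.mk R R C := by
      ext r c
      change (1 : R) ⊗ₜ[R] (r • c) = r ⊗ₜ c
      rw [← TensorProduct.smul_tmul, smul_eq_mul, mul_one]
    rw [← h1]
    refine Function.Bijective.comp ?_ hbij
    exact (LinearEquiv.congrRight (TensorProduct.lid R C).symm :
      (C →ₗ[R] C) ≃ₗ[R] _).bijective
  ext_hom I _ _ _ i hi := ExtVanish.of_projective hi
  ext_length Y _ _ i hi := ExtVanish.of_projective hi
  shift := ⟨_, isExtShift_equiv (LinearEquiv.refl R R)⟩
  shift_tensor := ⟨_, isExtShift_equiv (TensorProduct.lid R C)⟩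
  tors := by simp

lemma IsChainModule.isSMulRegular {rs : List R} (h : IsChainModule C rs D) {x : R}
    (hreg : RingTheory.Sequence.IsWeaklyRegular R (rs ++ [x])) : IsSMulRegular D x := by
  rw [isSMulRegular_iff_right_eq_zero_of_smul]
  intro d hd
  have hN : ∀ (r : R) (s : ℕ), r ^ s • d = 0 → ∀ t : Submodule.span R {d}, r ^ s • t = 0 := by
    rintro r s hrs ⟨t, ht⟩
    obtain ⟨a, rfl⟩ := Submodule.mem_span_singleton.1 ht
    refine Subtype.ext ?_
    change r ^ s • a • d = 0
    rw [smul_comm, hrs, smul_zero]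
  have hrs : TorsBy rs (Submodule.span R {d}) := fun r hr ↦ by
    obtain ⟨s, hs⟩ := h.tors r hr d
    exact ⟨s, hN r s hs⟩
  obtain ⟨e, he⟩ := h.shift
  have h1 := (he.extVanish hrs (zero_add _)).2 (ExtVanish.of_isWeaklyRegular (rs ++ [x])
    (fun r hr ↦ by
      rcases List.mem_append.1 hr with hr | hr
      · exact hrs r hr
      · obtain rfl : r = x := by simpa using hr
        exact ⟨1, hN r 1 (by simpa using hd)⟩) R hreg _ (by simp))
  have := LinearMap.congr_fun (ExtVanish.zero_iff.1 h1 (Submodule.subtype _))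
    ⟨d, Submodule.mem_span_singleton_self d⟩
  exact this

lemma IsChainModule.isSMulRegular_tensor [IsNoetherianRing R] [Module.Finite R C]
    (hann : Module.annihilator R C = ⊥) {rs : List R}
    (h : IsChainModule C rs D) {x : R} (hx : IsSMulRegular D x) :
    IsSMulRegular (D ⊗[R] C) x := by
  rw [isSMulRegular_iff_right_eq_zero_of_smul]
  intro t ht
  let T := LinearMap.ker (LinearMap.lsmul R (D ⊗[R] C) x)
  have : Subsingleton T := subsingleton_of_hom_eq_zero (X := C) hann fun f ↦ by
    obtain ⟨d, hd⟩ := h.unit_bijective.2 (T.subtype ∘ₗ f)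
    have h1 : d = 0 := by
      refine hx.right_eq_zero_of_smul (h.unit_bijective.1 ?_)
      rw [map_smul, hd, map_zero]
      ext c
      exact (f c).2
    rw [h1, map_zero] at hd
    ext c
    exact (LinearMap.congr_fun hd c).symm
  exact congr_arg Subtype.val (Subsingleton.elim (⟨t, ht⟩ : T) 0)

lemma unit_bijective_away [Module.Finite R C] {x : R} {g : A →ₗ[R] B}
    (hg : IsAwayEmbedding x g) (hgC : IsAwayEmbedding x (g.rTensor C))
    (h : Function.Bijective (TensorProduct.mk R A C)) :
    Function.Bijective (TensorProduct.mk R B C) := by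
  have hmk : ∀ a : A, TensorProduct.mk R B C (g a) = g.rTensor C ∘ₗ TensorProduct.mk R A C a :=
    fun a ↦ rfl
  refine ⟨(injective_iff_map_eq_zero _).2 fun b hb ↦ ?_, fun φ ↦ ?_⟩
  · obtain ⟨s, a, ha⟩ := hg.surj b
    have h1 : TensorProduct.mk R A C a = 0 := by
      ext c
      refine hgC.inj ?_
      have := LinearMap.congr_fun (hmk a) c
      rw [← ha, map_smul, hb, smul_zero] at this
      exact this.symm.trans (map_zero _).symm
    have h2 : a = 0 := h.1 (h1.trans (map_zero _).symm)
    refine (hg.bij_pow s).1 ?_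
    simp only [ha, h2, map_zero, smul_zero]
  · obtain ⟨s, ψ, hψ⟩ := hgC.exists_comp_eq φ
    obtain ⟨a, rfl⟩ := h.2 ψ
    obtain ⟨b, hb⟩ := (hg.bij_pow s).2 (g a)
    refine ⟨b, ?_⟩
    ext c
    refine (hgC.bij_pow s).1 ?_
    have := LinearMap.congr_fun hψ c
    have h3 := LinearMap.congr_fun (hmk a) c
    dsimp only at hb ⊢
    rw [← hb, map_smul] at h3
    exact h3.trans this

lemma unit_bijective_coker {f : A →ₗ[R] B} {g : B →ₗ[R] D} (hfg : Function.Exact f g)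
    (hg : Function.Surjective g)
    (hfC : Function.Injective (f.rTensor C)) (hA : Function.Bijective (TensorProduct.mk R A C))
    (hB : Function.Bijective (TensorProduct.mk R B C)) (hext : ExtVanish R C (A ⊗[R] C) 1) :
    Function.Bijective (TensorProduct.mk R D C) := by
  have hex := rTensor_exact C hfg hg
  refine ⟨(injective_iff_map_eq_zero _).2 fun d hd ↦ ?_, fun φ ↦ ?_⟩
  · obtain ⟨b, rfl⟩ := hg d
    have h1 : ∀ c, TensorProduct.mk R B C b c ∈ LinearMap.range (f.rTensor C) := fun c ↦
      (hex _).1 (LinearMap.congr_fun hd c)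
    let e := LinearEquiv.ofInjective _ hfC
    obtain ⟨a, ha⟩ := hA.2 (e.symm.toLinearMap ∘ₗ LinearMap.codRestrict _ _ h1)
    have h2 : f a = b := hB.1 <| by
      ext c
      have h3 := congr_arg Subtype.val
        (e.apply_symm_apply (LinearMap.codRestrict _ (TensorProduct.mk R B C b) h1 c))
      have h4 := LinearMap.congr_fun ha c
      refine Eq.trans ?_ h3
      exact congr_arg (f.rTensor C) h4
    rw [← h2, hfg.apply_apply_eq_zero]
  · obtain ⟨ψ, rfl⟩ := ExtVanish.exists_lift hfC hex (LinearMap.rTensor_surjective C hg) hext φ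
    obtain ⟨b, rfl⟩ := hB.2 ψ
    exact ⟨g b, rfl⟩

lemma IsChainModule.snoc [IsNoetherianRing R] [Module.Finite R C]
    (hann : Module.annihilator R C = ⊥) {rs : List R} (h : IsChainModule C rs D) {x : R}
    (hreg : RingTheory.Sequence.IsWeaklyRegular R (rs ++ [x])) :
    ∃ (D' : Type u) (_ : AddCommGroup D') (_ : Module R D'), IsChainModule C (rs ++ [x]) D' := by
  have hx := h.isSMulRegular hreg
  have hxC := h.isSMulRegular_tensor hann hx
  let S := Submonoid.powers x
  let f : D →ₗ[R] LocalizedModule S D := LocalizedModule.mkLinearMap S D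
  have hf : IsAwayEmbedding x f := .of_isLocalizedModule hx f
  have hloc : IsLocalizedModule S (f.rTensor C) :=
    IsLocalizedModule.rTensor (A := R) (R := R) S (N := C) f
  have hfC : IsAwayEmbedding x (f.rTensor C) := .of_isLocalizedModule hxC _
  let g := (LinearMap.range f).mkQ
  have hfg : Function.Exact f g := LinearMap.exact_map_mkQ_range f
  have hg : Function.Surjective g := Submodule.mkQ_surjective _
  have hfgC := rTensor_exact C hfg hg
  have hgC := LinearMap.rTensor_surjective C hg
  refine ⟨LocalizedModule S D ⧸ LinearMap.range f, inferInstance, inferInstance, ?_⟩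
  refine ⟨fun i hi ↦ ?_, ?_, fun I _ _ hI i hi ↦ ?_, fun Y _ _ i hi ↦ ?_, ?_, ?_, ?_⟩
  · exact ExtVanish.co_right hfC.inj hfgC hgC (hfC.extVanish (h.ext_tensor i hi))
      (h.ext_tensor _ (by omega))
  · exact unit_bijective_coker hfg hg hfC.inj h.unit_bijective
      (unit_bijective_away hf hfC h.unit_bijective) (h.ext_tensor 1 le_rfl)
  · have h1 : ExtVanish R (LocalizedModule S D) (C →ₗ[R] I) 1 :=
      hf.extVanish_left_one (h.ext_hom I hI 1 le_rfl) fun k ↦ by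
        have hinj : Function.Injective ((LinearMap.lsmul R D x).rTensor C) := by
          have : (LinearMap.lsmul R D x).rTensor C = LinearMap.lsmul R (D ⊗[R] C) x := by
            ext d c
            rfl
          rw [this]
          exact hxC
        obtain ⟨l, rfl⟩ := exists_extend_of_rTensor_injective hinj k
        exact ⟨l, by ext d c; simp⟩
    obtain _ | _ | i := i
    · omega
    · exact ExtVanish.of_exists_extend hf.inj hfg hg h1
        (exists_extend_of_rTensor_injective hfC.inj)
    · exact ExtVanish.contra_right hf.inj hfg hg (h.ext_hom I hI _ (by omega))
        (hf.extVanish_left (h.ext_hom I hI _ (by omega)) (h.ext_hom I hI _ (by omega)))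
  · rw [List.length_append, List.length_singleton] at hi
    obtain ⟨i, rfl⟩ := Nat.exists_eq_add_of_le' (show 2 ≤ i by omega)
    exact ExtVanish.contra_right hf.inj hfg hg (h.ext_length Y _ (by omega))
      (hf.extVanish_left (h.ext_length Y _ (by omega)) (h.ext_length Y _ (by omega)))
  · obtain ⟨e, he⟩ := h.shift
    rw [List.length_append, List.length_singleton]
    exact ⟨_, he.snoc hf.inj hfg hg hf.bij⟩
  · obtain ⟨e, he⟩ := h.shift_tensor
    rw [List.length_append, List.length_singleton]
    exact ⟨_, he.snoc hfC.inj hfgC hgC hfC.bij⟩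
  · intro r hr d
    obtain ⟨b, rfl⟩ := hg d
    obtain ⟨s, a, ha⟩ := hf.surj b
    rcases List.mem_append.1 hr with hr | hr
    · obtain ⟨t, ht⟩ := h.tors r hr a
      refine ⟨t, ?_⟩
      have : r ^ t • b = 0 := (hf.bij_pow s).1 (by
        dsimp only
        rw [smul_comm, ha, ← map_smul, ht, map_zero, smul_zero])
      rw [← map_smul, this, map_zero]
    · obtain rfl : r = x := by simpa using hr
      exact ⟨s, by rw [← map_smul, ha, hfg.apply_apply_eq_zero]⟩

lemma exists_isChainModule [IsNoetherianRing R] [Module.Finite R C]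
    (hbij : Function.Bijective (LinearMap.lsmul R C))
    (hext : ∀ i, 1 ≤ i → ExtVanish R C C i) (rs : List R)
    (hreg : RingTheory.Sequence.IsWeaklyRegular R rs) :
    ∃ (D : Type u) (_ : AddCommGroup D) (_ : Module R D), IsChainModule C rs D := by
  have hann : Module.annihilator R C = ⊥ := by
    refine (Submodule.eq_bot_iff _).2 fun r hr ↦ hbij.1 ?_
    rw [map_zero]
    ext c
    exact Module.mem_annihilator.1 hr c
  induction rs using List.reverseRecOn with
  | nil => exact ⟨R, inferInstance, inferInstance, isChainModule_nil hbij hext⟩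
  | append_singleton rs x ih =>
    obtain ⟨D, _, _, hD⟩ := ih ((RingTheory.Sequence.isWeaklyRegular_append_iff _ _ _).1 hreg).1
    exact hD.snoc hann hreg

end

section

variable {R : Type u} [CommRing R] {J : Ideal R} {D Y : Type u} [AddCommGroup D] [Module R D]
  [AddCommGroup Y] [Module R Y]

/-- The map `R ⧸ J ^ t → D` sending `1` to an element killed by `J ^ t`. -/
def powLift (t : ℕ) (d : D) (h : ∀ r ∈ J ^ t, r • d = 0) : (R ⧸ J ^ t) →ₗ[R] D :=
  Submodule.liftQ (J ^ t) (LinearMap.toSpanSingleton R D d) h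

lemma exists_powLift_eq {t : ℕ} (f : (R ⧸ J ^ t) →ₗ[R] D) : ∃ d h, powLift t d h = f := by
  refine ⟨f (Submodule.Quotient.mk 1), fun r hr ↦ ?_, ?_⟩
  · rw [← map_smul, ← Submodule.Quotient.mk_smul, smul_eq_mul, mul_one,
      (Submodule.Quotient.mk_eq_zero _).2 hr, map_zero]
  · refine Submodule.linearMap_qext _ (LinearMap.ext_ring ?_)
    exact one_smul _ _

namespace localCohomology

variable {n : ℕ} (e : Abelian.Ext (ModuleCat.of R D) (ModuleCat.of R Y) n)

/-- The class in local cohomology of an element killed by `J ^ t`, obtained by composing the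
corresponding map `R ⧸ J ^ t → D` with a fixed class in `Ext D Y n`. -/
noncomputable def ofTors (t : ℕ) (d : D) (h : ∀ r ∈ J ^ t, r • d = 0) :
    (localCohomology J n).obj (ModuleCat.of R Y) :=
  ofExt J n (ModuleCat.of R Y) t
    ((Abelian.Ext.mk₀ (ModuleCat.ofHom (powLift t d h))).comp e (zero_add n))

lemma mk₀_powProj_comp {t s : ℕ} (hts : t ≤ s) (d : D) (h : ∀ r ∈ J ^ t, r • d = 0) :
    (Abelian.Ext.mk₀ (powProj J hts)).comp
      ((Abelian.Ext.mk₀ (ModuleCat.ofHom (powLift t d h))).comp e (zero_add n)) (zero_add n) =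
    (Abelian.Ext.mk₀ (ModuleCat.ofHom (powLift s d
      (fun r hr ↦ h r (Ideal.pow_le_pow_right hts hr))))).comp e (zero_add n) := by
  have h1 : powProj J hts ≫ ModuleCat.ofHom (powLift t d h) = ModuleCat.ofHom (powLift s d
      (fun r hr ↦ h r (Ideal.pow_le_pow_right hts hr))) := by
    ext
    rfl
  rw [← h1, ← Abelian.Ext.mk₀_comp_mk₀, Abelian.Ext.comp_assoc_of_second_deg_zero]

lemma ofTors_eq {t s : ℕ} (d : D) (h : ∀ r ∈ J ^ t, r • d = 0) (h' : ∀ r ∈ J ^ s, r • d = 0) :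
    ofTors e t d h = ofTors e s d h' := by
  wlog hts : t ≤ s generalizing t s
  · exact (this h' h (not_le.1 hts).le).symm
  unfold ofTors
  rw [← mk₀_powProj_comp e hts d h, ofExt_powProj]

/-- The linear map `ofTors` on a module all of whose elements are killed by powers of `J`. -/
noncomputable def ofTorsLinear (hD : ∀ d : D, ∃ t : ℕ, ∀ r ∈ J ^ t, r • d = 0) :
    D →ₗ[R] (localCohomology J n).obj (ModuleCat.of R Y) where
  toFun d := ofTors e _ d (hD d).choose_spec
  map_add' a b := by
    have ha : ∀ r ∈ J ^ ((hD a).choose + (hD b).choose), r • a = 0 := fun r hr ↦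
      (hD a).choose_spec r (Ideal.pow_le_pow_right (Nat.le_add_right _ _) hr)
    have hb : ∀ r ∈ J ^ ((hD a).choose + (hD b).choose), r • b = 0 := fun r hr ↦
      (hD b).choose_spec r (Ideal.pow_le_pow_right (Nat.le_add_left _ _) hr)
    have hab : ∀ r ∈ J ^ ((hD a).choose + (hD b).choose), r • (a + b) = 0 := fun r hr ↦ by
      rw [smul_add, ha r hr, hb r hr, add_zero]
    rw [ofTors_eq e a _ ha, ofTors_eq e b _ hb, ofTors_eq e (a + b) _ hab]
    have h1 : ModuleCat.ofHom (powLift _ _ hab) =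
        ModuleCat.ofHom (powLift _ _ ha) + ModuleCat.ofHom (powLift _ _ hb) := by
      ext
      exact smul_add _ _ _
    unfold ofTors
    rw [h1, Abelian.Ext.mk₀_add, Abelian.Ext.add_comp, map_add]
  map_smul' c a := by
    have ha := (hD a).choose_spec
    have hca : ∀ r ∈ J ^ (hD a).choose, r • (c • a) = 0 := fun r hr ↦ by
      rw [smul_comm, ha r hr, smul_zero]
    rw [ofTors_eq e (c • a) _ hca]
    have h1 : ModuleCat.ofHom (powLift _ _ hca) = c • ModuleCat.ofHom (powLift _ _ ha) := by
      ext
      exact smul_comm _ _ _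
    unfold ofTors
    rw [h1, Abelian.Ext.mk₀_smul, Abelian.Ext.smul_comp, map_smul, RingHom.id_apply]

lemma ofTorsLinear_apply (hD : ∀ d : D, ∃ t : ℕ, ∀ r ∈ J ^ t, r • d = 0) {t : ℕ} (d : D)
    (h : ∀ r ∈ J ^ t, r • d = 0) : ofTorsLinear e hD d = ofTors e t d h :=
  ofTors_eq e d _ h

lemma ofTorsLinear_bijective (hD : ∀ d : D, ∃ t : ℕ, ∀ r ∈ J ^ t, r • d = 0)
    (he : ∀ t : ℕ, Function.Bijective
      (fun φ : Abelian.Ext (ModuleCat.of R (R ⧸ J ^ t)) (ModuleCat.of R D) 0 ↦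
        φ.comp e (zero_add n))) :
    Function.Bijective (ofTorsLinear e hD) := by
  constructor
  · rw [injective_iff_map_eq_zero]
    intro d hd
    obtain ⟨s, hs, h1⟩ := ofExt_eq_zero J n _ hd
    have h2 := (he s).1 ((mk₀_powProj_comp e hs d (hD d).choose_spec).symm.trans
      (h1.trans (Abelian.Ext.zero_comp ..).symm))
    rw [Abelian.Ext.mk₀_eq_zero_iff] at h2
    have h3 := LinearMap.congr_fun (congr_arg ModuleCat.Hom.hom h2) (Submodule.Quotient.mk 1)
    exact (one_smul R d).symm.trans h3
  · intro x
    obtain ⟨t, α, rfl⟩ := exists_ofExt J n _ x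
    obtain ⟨φ, rfl⟩ := (he t).2 α
    obtain ⟨f, rfl⟩ := (Abelian.Ext.mk₀_bijective _ _).2 φ
    obtain ⟨d, h, hd⟩ := exists_powLift_eq f.hom
    refine ⟨d, (ofTorsLinear_apply e hD d h).trans ?_⟩
    unfold ofTors
    rw [hd]
    rfl

end localCohomology

variable {C : Type u} [AddCommGroup C] [Module R C]

lemma exists_pow_smul_eq_zero {rs : List R} (x : D)
    (h : ∀ r ∈ rs, ∃ s : ℕ, r ^ s • x = 0) {t : ℕ} (ht : J ^ t ≤ Ideal.ofList rs) :
    ∃ t : ℕ, ∀ r ∈ J ^ t, r • x = 0 := by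
  have h1 : Ideal.ofList rs ≤ (Module.annihilator R (Submodule.span R {x})).radical := by
    rw [Ideal.ofList, Ideal.span_le]
    intro r hr
    obtain ⟨s, hs⟩ := h r hr
    refine ⟨s, ?_⟩
    rw [Module.mem_annihilator]
    rintro ⟨y, hy⟩
    obtain ⟨a, rfl⟩ := Submodule.mem_span_singleton.1 hy
    refine Subtype.ext ?_
    change r ^ s • a • x = 0
    rw [smul_comm, hs, smul_zero]
  obtain ⟨k, hk⟩ := Ideal.exists_pow_le_of_le_radical_of_fg h1
    ⟨rs.finite_toSet.toFinset, by simp [Ideal.ofList]⟩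
  refine ⟨t * k, fun r hr ↦ ?_⟩
  rw [pow_mul] at hr
  have h2 := hk (Ideal.pow_right_mono ht k hr)
  rw [Module.mem_annihilator] at h2
  exact congr_arg Subtype.val (h2 ⟨x, Submodule.mem_span_singleton_self x⟩)

lemma torsBy_of_pow_smul {rs : List R} (hrs : ∀ r ∈ rs, r ∈ J) {s : ℕ}
    (h : ∀ r ∈ J ^ s, ∀ x : D, r • x = 0) : TorsBy rs D := fun r hr ↦
  ⟨s, h _ (Ideal.pow_mem_pow (hrs r hr) s)⟩

lemma smul_quotient_pow (J : Ideal R) (t : ℕ) : ∀ r ∈ J ^ t, ∀ x : R ⧸ J ^ t, r • x = 0 := by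
  rintro r hr ⟨x⟩
  exact (Submodule.Quotient.mk_eq_zero _).2 (Ideal.mul_mem_right _ _ hr)

lemma IsChainModule.exists_pow_smul {rs : List R} (h : IsChainModule C rs D) {t : ℕ}
    (ht : J ^ t ≤ Ideal.ofList rs) (d : D) : ∃ t : ℕ, ∀ r ∈ J ^ t, r • d = 0 :=
  exists_pow_smul_eq_zero d (fun r hr ↦ h.tors r hr d) ht

lemma IsChainModule.exists_pow_smul_tensor {rs : List R} (h : IsChainModule C rs D) {t : ℕ}
    (ht : J ^ t ≤ Ideal.ofList rs) (x : D ⊗[R] C) : ∃ t : ℕ, ∀ r ∈ J ^ t, r • x = 0 := by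
  induction x with
  | zero => exact ⟨0, by simp⟩
  | tmul d c =>
    obtain ⟨s, hs⟩ := h.exists_pow_smul ht d
    exact ⟨s, fun r hr ↦ by rw [TensorProduct.smul_tmul', hs r hr, TensorProduct.zero_tmul]⟩
  | add x y hx hy =>
    obtain ⟨s, hs⟩ := hx
    obtain ⟨t, ht⟩ := hy
    exact ⟨s + t, fun r hr ↦ by
      rw [smul_add, hs r (Ideal.pow_le_pow_right (Nat.le_add_right _ _) hr),
        ht r (Ideal.pow_le_pow_right (Nat.le_add_left _ _) hr), add_zero]⟩

lemma IsChainModule.nonempty_equiv {rs : List R} (h : IsChainModule C rs D)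
    (hrs : ∀ r ∈ rs, r ∈ J) {t : ℕ} (ht : J ^ t ≤ Ideal.ofList rs) :
    Nonempty (D ≃ₗ[R] (localCohomology J rs.length).obj (ModuleCat.of R R)) := by
  obtain ⟨e, he⟩ := h.shift
  exact ⟨LinearEquiv.ofBijective _ (localCohomology.ofTorsLinear_bijective e
    (h.exists_pow_smul ht) fun s ↦ he _ (torsBy_of_pow_smul hrs (smul_quotient_pow J s)) _ _ _)⟩

/-- The isomorphism `D ≃ Hom(C, D ⊗ C)`. -/
noncomputable def IsChainModule.unitEquiv {rs : List R} (h : IsChainModule C rs D) :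
    D ≃ₗ[R] (C →ₗ[R] D ⊗[R] C) :=
  LinearEquiv.ofBijective (TensorProduct.mk R D C) h.unit_bijective

end

section

variable {R : Type u} [CommRing R]

lemma exists_comp_eq_of_ker_le {A B E : Type u} [AddCommGroup A] [Module R A] [AddCommGroup B]
    [Module R B] [AddCommGroup E] [Module R E] (q : A →ₗ[R] B) (hq : Function.Surjective q)
    (f : A →ₗ[R] E) (h : LinearMap.ker q ≤ LinearMap.ker f) : ∃ g : B →ₗ[R] E, g ∘ₗ q = f := by
  refine ⟨(LinearMap.ker q).liftQ f h ∘ₗ (q.quotKerEquivOfSurjective hq).symm.toLinearMap, ?_⟩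
  ext a
  change (LinearMap.ker q).liftQ f h ((q.quotKerEquivOfSurjective hq).symm (q a)) = _
  rw [LinearMap.quotKerEquivOfSurjective_symm_apply]
  rfl
end

section

variable {R : Type u} [CommRing R] [IsLocalRing R]

/-- The quotient of a finite module by a regular sequence, with its vanishing range for `Ext`. -/
lemma exists_quotient_extVanish (rs : List R) (hrs : ∀ r ∈ rs, r ∈ IsLocalRing.maximalIdeal R) :
    ∀ (j : ℕ) (M : Type u) [AddCommGroup M] [Module R M] [Module.Finite R M] [Nontrivial M],
    RingTheory.Sequence.IsWeaklyRegular M rs →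
    (∀ (Y : Type u) [AddCommGroup Y] [Module R Y] (i : ℕ), j < i → ExtVanish R M Y i) →
    ∃ (Q : Type u) (_ : AddCommGroup Q) (_ : Module R Q), Module.Finite R Q ∧ Nontrivial Q ∧
      Ideal.ofList rs ≤ Module.annihilator R Q ∧
      Module.annihilator R M ≤ Module.annihilator R Q ∧
      ∀ (Y : Type u) [AddCommGroup Y] [Module R Y] (i : ℕ), j + rs.length < i →
        ExtVanish R Q Y i := by
  induction rs with
  | nil =>
    intro j M _ _ _ _ _ H
    exact ⟨M, inferInstance, inferInstance, inferInstance, inferInstance, by simp, le_rfl, H⟩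
  | cons x rs ih =>
    intro j M _ _ _ _ hreg H
    obtain ⟨hx, hreg⟩ := (RingTheory.Sequence.isWeaklyRegular_cons_iff _ _ _).1 hreg
    have hxm := hrs x (by simp)
    have := nontrivial_quotSMulTop_of_mem_maximalIdeal M hxm
    obtain ⟨Q, _, _, h1, h2, h3, h4, h5⟩ := ih (fun r hr ↦ hrs r (by simp [hr])) (j + 1)
      (QuotSMulTop x M) hreg fun Y _ _ i hi ↦ by
        obtain ⟨i, rfl⟩ := Nat.exists_eq_add_of_le' (show 1 ≤ i by omega)
        exact ExtVanish.contra_right (f := LinearMap.lsmul R M x) hx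
          (LinearMap.exact_lsmul_mkQ_smul_top M x) (Submodule.mkQ_surjective _)
          (H Y i (by omega)) (H Y (i + 1) (by omega))
    refine ⟨Q, inferInstance, inferInstance, h1, h2, ?_, le_trans ?_ h4, fun Y _ _ i hi ↦ ?_⟩
    · rw [Ideal.ofList_cons, sup_le_iff, Ideal.span_le, Set.singleton_subset_iff]
      refine ⟨h4 (Module.mem_annihilator.2 fun y ↦ ?_), h3⟩
      obtain ⟨y, rfl⟩ := Submodule.mkQ_surjective _ y
      rw [← map_smul]
      exact (Submodule.Quotient.mk_eq_zero _).2
        (Submodule.smul_mem_pointwise_smul y x ⊤ trivial)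
    · exact LinearMap.annihilator_le_of_surjective _ (Submodule.mkQ_surjective _)
    · exact h5 Y i (by simp at hi; omega)

end

section

variable {R : Type u} [CommRing R] [IsNoetherianRing R]

/-- A torsion module `E` with `Ext¹(T, E) = 0` for all finite torsion `T` is injective. -/
lemma injective_of_torsion {E : Type u} [AddCommGroup E] [Module R E] (J : Ideal R)
    (hE : ∀ x : E, ∃ t : ℕ, ∀ r ∈ J ^ t, r • x = 0)
    (H : ∀ (T : Type u) [AddCommGroup T] [Module R T] [Module.Finite R T] (s : ℕ),
      (∀ r ∈ J ^ s, ∀ x : T, r • x = 0) → ExtVanish R T E 1) : Module.Injective R E := by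
  refine Module.Baer.injective fun I f ↦ ?_
  obtain ⟨s, hs⟩ : ∃ s : ℕ, ∀ r ∈ J ^ s, ∀ x : I, r • f x = 0 := by
    obtain ⟨S, hS⟩ := (inferInstance : Module.Finite R I).fg_top
    choose τ hτ using hE
    refine ⟨∑ x ∈ S, τ (f x), fun r hr x ↦ ?_⟩
    have hx : x ∈ Submodule.span R (S : Set I) := hS ▸ trivial
    induction hx using Submodule.span_induction with
    | mem x hx =>
      exact hτ _ r (Ideal.pow_le_pow_right
        (Finset.single_le_sum (f := fun x ↦ τ (f x)) (fun _ _ ↦ Nat.zero_le _) hx) hr)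
    | zero => simp
    | add x y _ _ hx hy => rw [map_add, smul_add, hx, hy, add_zero]
    | smul a x _ hx => rw [map_smul, smul_comm, hx, smul_zero]
  obtain ⟨k, hk⟩ := Ideal.exists_pow_inf_eq_pow_smul J I
  have hIJ : ∀ x : I, (x : R) ∈ J ^ (s + k) → f x = 0 := by
    intro x hx
    have h1 := hk (s + k) (by omega)
    rw [Nat.add_sub_cancel] at h1
    have h2 : (x : R) ∈ J ^ s • I := by
      have h3 : (x : R) ∈ J ^ (s + k) • (⊤ : Ideal R) ⊓ I := ⟨by simpa using hx, x.2⟩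
      rw [h1] at h3
      exact Submodule.smul_mono le_rfl inf_le_right h3
    have h3 : J ^ s • I ≤ (LinearMap.ker f).map I.subtype := by
      refine Submodule.smul_le.2 fun r hr y hy ↦ ?_
      exact ⟨r • ⟨y, hy⟩, (map_smul f _ _).trans (hs r hr _), rfl⟩
    obtain ⟨y, hy, hyx⟩ := h3 h2
    rwa [Subtype.ext hyx] at hy
  obtain ⟨g, hg⟩ := exists_comp_eq_of_ker_le ((Submodule.mkQ (J ^ (s + k))).submoduleMap I)
    (LinearMap.submoduleMap_surjective _ _) f fun x hx ↦
      hIJ x ((Submodule.Quotient.mk_eq_zero _).1 (congr_arg Subtype.val hx))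
  obtain ⟨l, hl⟩ := ExtVanish.exists_extend (Submodule.subtype_injective _)
    (LinearMap.exact_subtype_mkQ (Submodule.map (Submodule.mkQ (J ^ (s + k))) I))
    (Submodule.mkQ_surjective _)
    (H _ (s + k) fun r hr x ↦ by
      obtain ⟨x, rfl⟩ := Submodule.mkQ_surjective _ x
      rw [← map_smul, smul_quotient_pow J _ r hr, map_zero]) g
  refine ⟨l ∘ₗ Submodule.mkQ _, fun x hx ↦ ?_⟩
  exact (LinearMap.congr_fun hl _).trans (LinearMap.congr_fun hg ⟨x, hx⟩)

end

section

variable {R : Type u} [CommRing R] [IsNoetherianRing R] [IsLocalRing R]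

lemma exists_residueField_embedding (Q : Type u) [AddCommGroup Q] [Module R Q] [Nontrivial Q]
    {t : ℕ} (ht : IsLocalRing.maximalIdeal R ^ t ≤ Module.annihilator R Q) :
    ∃ f : (R ⧸ IsLocalRing.maximalIdeal R) →ₗ[R] Q, Function.Injective f := by
  obtain ⟨p, hp⟩ := associatedPrimes.nonempty R Q
  have h1 : IsLocalRing.maximalIdeal R ≤ p := hp.isPrime.le_of_pow_le
    (ht.trans (Submodule.annihilator_top.ge.trans hp.annihilator_le))
  obtain rfl := (IsLocalRing.maximalIdeal.isMaximal R).eq_of_le hp.isPrime.ne_top h1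
  exact ((isAssociatedPrime_iff_exists_injective_linearMap _ _).1 hp).2

namespace ExtVanish

/-- Over a Cohen-Macaulay ring, vanishing of `Ext^i(k, Y)` for large `i` implies vanishing beyond
the dimension. -/
lemma residueField_of_large {rs : List R} (hrs : ∀ r ∈ rs, r ∈ IsLocalRing.maximalIdeal R)
    (hreg : RingTheory.Sequence.IsWeaklyRegular R rs) {t : ℕ}
    (ht : IsLocalRing.maximalIdeal R ^ t ≤ Ideal.ofList rs)
    {Y : Type u} [AddCommGroup Y] [Module R Y] (N : ℕ)
    (H : ∀ i, N < i → ExtVanish R (R ⧸ IsLocalRing.maximalIdeal R) Y i) :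
    ∀ i, rs.length < i → ExtVanish R (R ⧸ IsLocalRing.maximalIdeal R) Y i := by
  obtain ⟨Q, _, _, h1, h2, h3, -, h5⟩ := exists_quotient_extVanish rs hrs 0 R hreg
    (fun Y _ _ i hi ↦ of_projective hi)
  obtain ⟨f, hf⟩ := exists_residueField_embedding Q (ht.trans h3)
  induction N with
  | zero => exact fun i hi ↦ H i (by omega)
  | succ N ih =>
    by_cases hN : rs.length ≤ N
    · refine ih fun i hi ↦ ?_
      refine contra_left hf (LinearMap.exact_map_mkQ_range f) (Submodule.mkQ_surjective _)
        (h5 Y i (by omega)) ?_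
      refine of_residueField (s := t) (fun r hr q ↦ ?_) (H (i + 1) (by omega))
      obtain ⟨q, rfl⟩ := Submodule.mkQ_surjective _ q
      rw [← map_smul, Module.mem_annihilator.1 (h3 (ht hr)), map_zero]
    · exact fun i hi ↦ H i (by omega)

end ExtVanish

/-- If `C` has finite injective dimension then `D ⊗ C` is injective. -/
lemma IsChainModule.injective_tensor {C D : Type u} [AddCommGroup C] [Module R C]
    [AddCommGroup D] [Module R D] {rs : List R} (h : IsChainModule C rs D)
    (hrs : ∀ r ∈ rs, r ∈ IsLocalRing.maximalIdeal R)
    (hreg : RingTheory.Sequence.IsWeaklyRegular R rs) {t : ℕ}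
    (ht : IsLocalRing.maximalIdeal R ^ t ≤ Ideal.ofList rs) {N : ℕ}
    (H : ∀ i, N < i → ExtVanish R (R ⧸ IsLocalRing.maximalIdeal R) C i) :
    Module.Injective R (D ⊗[R] C) := by
  obtain ⟨e, he⟩ := h.shift_tensor
  refine injective_of_torsion (IsLocalRing.maximalIdeal R) (h.exists_pow_smul_tensor ht)
    fun T _ _ _ s hs ↦ ?_
  refine (he.extVanish (torsBy_of_pow_smul hrs hs) (add_comm 1 rs.length)).2 ?_
  exact ExtVanish.of_residueField hs (ExtVanish.residueField_of_large hrs hreg ht N H _ (by omega))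

end

section

variable {R : Type u} [CommRing R]
variable {A B K F C J I : Type u} [AddCommGroup A] [Module R A] [AddCommGroup B] [Module R B]
  [AddCommGroup K] [Module R K] [AddCommGroup F] [Module R F] [AddCommGroup C] [Module R C]
  [AddCommGroup J] [Module R J] [AddCommGroup I] [Module R I]

lemma exists_comp_eq_of_injective [Module.Injective R J] (f : A →ₗ[R] B) (g : A →ₗ[R] J)
    (h : LinearMap.ker f ≤ LinearMap.ker g) : ∃ l : B →ₗ[R] J, l ∘ₗ f = g := by
  obtain ⟨k, hk⟩ := exists_comp_eq_of_ker_le f.rangeRestrict f.surjective_rangeRestrict g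
    (by rwa [LinearMap.ker_rangeRestrict])
  obtain ⟨l, hl⟩ := Module.Injective.out (LinearMap.range f).subtype
    (Submodule.subtype_injective _) k
  exact ⟨l, LinearMap.ext fun a ↦ (hl (f.rangeRestrict a)).trans (LinearMap.congr_fun hk a)⟩

variable (R K C J) in
/-- The evaluation map `K ⊗ Hom(C, J) → Hom(Hom(K, C), J)`. -/
noncomputable def homEval : K ⊗[R] (C →ₗ[R] J) →ₗ[R] ((K →ₗ[R] C) →ₗ[R] J) :=
  TensorProduct.lift ((LinearMap.llcomp R (K →ₗ[R] C) C J).flip ∘ₗ LinearMap.applyₗ)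

@[simp]
lemma homEval_tmul (k : K) (z : C →ₗ[R] J) (φ : K →ₗ[R] C) :
    homEval R K C J (k ⊗ₜ z) φ = z (φ k) := rfl

lemma homEval_rTensor (f : A →ₗ[R] B) (x : A ⊗[R] (C →ₗ[R] J)) :
    homEval R B C J (f.rTensor _ x) = homEval R A C J x ∘ₗ LinearMap.lcomp R C f := by
  induction x with
  | zero => simp
  | tmul a z => ext φ; simp
  | add x y hx hy => rw [map_add, map_add, hx, hy, map_add, LinearMap.add_comp]

lemma homEval_bijective_of_basis {ι : Type*} [Fintype ι] (b : Module.Basis ι R F) :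
    Function.Bijective (homEval R F C J) := by
  let inv : ((F →ₗ[R] C) →ₗ[R] J) → F ⊗[R] (C →ₗ[R] J) := fun ψ ↦
    ∑ i, b i ⊗ₜ[R] (ψ ∘ₗ LinearMap.smulRightₗ (b.coord i))
  refine Function.bijective_iff_has_inverse.2 ⟨inv, fun x ↦ ?_, fun ψ ↦ ?_⟩
  · induction x with
    | zero => simp [inv]
    | tmul f z =>
      have h1 : ∀ i, b i ⊗ₜ[R] (homEval R F C J (f ⊗ₜ z) ∘ₗ LinearMap.smulRightₗ (b.coord i)) =
          (b.repr f i • b i) ⊗ₜ[R] z := fun i ↦ by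
        rw [TensorProduct.smul_tmul]
        congr 1
        ext c
        simp
      change ∑ i, _ = _
      simp_rw [h1]
      rw [← TensorProduct.sum_tmul, b.sum_repr]
    | add x y hx hy =>
      have : inv (homEval R F C J (x + y)) = inv (homEval R F C J x) + inv (homEval R F C J y) := by
        simp only [inv, map_add, LinearMap.add_comp, TensorProduct.tmul_add,
          Finset.sum_add_distrib]
      rw [this, hx, hy]
  · ext φ
    have h1 : φ = ∑ i, (b.coord i).smulRight (φ (b i)) := by
      refine b.ext fun j ↦ ?_
      simp only [LinearMap.sum_apply, LinearMap.smulRight_apply, Module.Basis.coord_apply,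
        Module.Basis.repr_self]
      rw [Finset.sum_eq_single j (fun i _ hi ↦ by rw [Finsupp.single_eq_of_ne hi, zero_smul])
        (by simp), Finsupp.single_eq_same, one_smul]
    conv_rhs => rw [h1]
    simp [inv]

/-- The evaluation map is an isomorphism for `K` finite and `J` injective. -/
lemma homEval_bijective [IsNoetherianRing R] [Module.Finite R K] [Module.Injective R J] :
    Function.Bijective (homEval R K C J) := by
  obtain ⟨n, q, hq⟩ := Module.Finite.exists_fin' R K
  obtain ⟨m, p, hp⟩ := Module.Finite.exists_fin' R (LinearMap.ker q)
  have hn := homEval_bijective_of_basis (C := C) (J := J) (Pi.basisFun R (Fin n))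
  have hm := homEval_bijective_of_basis (C := C) (J := J) (Pi.basisFun R (Fin m))
  let f : (Fin m → R) →ₗ[R] (Fin n → R) := (LinearMap.ker q).subtype ∘ₗ p
  have hfq : Function.Exact f q := by
    refine LinearMap.exact_iff.2 ?_
    rw [LinearMap.range_comp, LinearMap.range_eq_top.2 hp, Submodule.map_top,
      Submodule.range_subtype]
  have hlq : Function.Injective (LinearMap.lcomp R C q) := fun a b hab ↦
    LinearMap.ext fun k ↦ by
      obtain ⟨x, rfl⟩ := hq k
      exact LinearMap.congr_fun hab x
  constructor
  · refine (injective_iff_map_eq_zero _).2 fun x hx ↦ ?_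
    obtain ⟨y, rfl⟩ := LinearMap.rTensor_surjective (C →ₗ[R] J) hq x
    rw [homEval_rTensor] at hx
    obtain ⟨w, hw⟩ := exists_comp_eq_of_injective (LinearMap.lcomp R C f)
      (homEval R (Fin n → R) C J y) fun φ hφ ↦ by
        obtain ⟨φ, rfl⟩ := exists_comp_eq_of_ker_le q hq φ fun v hv ↦ by
          obtain ⟨u, rfl⟩ := (hfq v).1 hv
          exact LinearMap.congr_fun hφ u
        exact LinearMap.congr_fun hx φ
    obtain ⟨z, rfl⟩ := hm.2 w
    rw [← homEval_rTensor] at hw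
    rw [← hn.1 hw, ← LinearMap.comp_apply, ← LinearMap.rTensor_comp, hfq.linearMap_comp_eq_zero,
      LinearMap.rTensor_zero, LinearMap.zero_apply]
  · intro ψ
    obtain ⟨w, hw⟩ := exists_comp_eq_of_injective (LinearMap.lcomp R C q) ψ fun φ hφ ↦ by
      rw [hlq (hφ.trans (map_zero _).symm)]
      exact zero_mem _
    obtain ⟨y, rfl⟩ := hn.2 w
    exact ⟨q.rTensor _ y, (homEval_rTensor q y).trans hw⟩

lemma rTensor_hom_injective [IsNoetherianRing R] [Module.Finite R A] [Module.Injective R J]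
    {f : A →ₗ[R] B} (hf : ∀ φ : A →ₗ[R] C, ∃ ψ : B →ₗ[R] C, ψ ∘ₗ f = φ) :
    Function.Injective (f.rTensor (C →ₗ[R] J)) := by
  refine (injective_iff_map_eq_zero _).2 fun x hx ↦ ?_
  refine (injective_iff_map_eq_zero _).1 (homEval_bijective (R := R) (K := A) (C := C)).1 x ?_
  ext φ
  obtain ⟨ψ, rfl⟩ := hf φ
  have h1 := (homEval_rTensor f x).symm
  rw [hx, map_zero] at h1
  exact LinearMap.congr_fun h1 ψ

/-- `Hom(F, I)` is injective for `F` flat and `I` injective. -/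
lemma injective_hom_of_flat [Module.Flat R F] (hI : Module.Injective R I) :
    Module.Injective R (F →ₗ[R] I) := ⟨fun _ _ _ _ _ _ f hf g ↦ by
  obtain ⟨l, hl⟩ := exists_extend_of_rTensor_injective
    (Module.Flat.rTensor_preserves_injective_linearMap (M := F) f hf) g
  exact ⟨l, LinearMap.congr_fun hl⟩⟩

namespace ExtVanish

/-- `Ext` from `Hom(C, J)` to `Hom(K, I)` vanishes in positive degrees when `J` and `I` are
injective and `Ext(K, C)` vanishes in positive degrees. -/
lemma hom_hom [IsNoetherianRing R] (hJ : Module.Injective R J) (hI : Module.Injective R I)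
    (i : ℕ) : ∀ (K : Type u) [AddCommGroup K] [Module R K] [Module.Finite R K],
    (∀ i, 1 ≤ i → ExtVanish R K C i) → ExtVanish R (C →ₗ[R] J) (K →ₗ[R] I) (i + 1) := by
  induction i with
  | zero =>
    intro K _ _ _ H
    obtain ⟨n, q, hq⟩ := Module.Finite.exists_fin' R K
    have hF := injective_hom_of_flat (F := Fin n → R) hI
    have hfq := LinearMap.exact_subtype_ker_map q
    refine of_exists_lift (LinearMap.lcomp_injective_of_surjective _ hq)
      (LinearMap.exact_lcomp_of_exact_of_surjective I hfq hq)
      (fun k ↦ ?_) (of_injective le_rfl) fun k ↦ ?_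
    · obtain ⟨l, hl⟩ := Module.Injective.out _ (Submodule.subtype_injective (LinearMap.ker q)) k
      exact ⟨l, LinearMap.ext hl⟩
    · obtain ⟨l, hl⟩ := Module.Injective.out _ (rTensor_hom_injective (J := J)
        (exists_extend (Submodule.subtype_injective _) hfq hq (H 1 le_rfl)))
        (TensorProduct.lift k.flip)
      refine ⟨(TensorProduct.curry l).flip, ?_⟩
      ext z x
      exact hl (x ⊗ₜ z)
  | succ i ih =>
    intro K _ _ _ H
    obtain ⟨n, q, hq⟩ := Module.Finite.exists_fin' R K
    have hF := injective_hom_of_flat (F := Fin n → R) hI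
    have hfq := LinearMap.exact_subtype_ker_map q
    refine co_left (LinearMap.lcomp_injective_of_surjective _ hq)
      (LinearMap.exact_lcomp_of_exact_of_surjective I hfq hq)
      (fun k ↦ ?_) (of_injective (by omega)) (ih _ fun j hj ↦ ?_)
    · obtain ⟨l, hl⟩ := Module.Injective.out _ (Submodule.subtype_injective (LinearMap.ker q)) k
      exact ⟨l, LinearMap.ext hl⟩
    · exact contra_left (Submodule.subtype_injective _) hfq hq (of_projective hj) (H _ (by omega))

end ExtVanish

lemma injective_of_linearEquiv (e : A ≃ₗ[R] B) (hA : Module.Injective R A) :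
    Module.Injective R B := ⟨fun _ _ _ _ _ _ f hf g ↦ by
  obtain ⟨l, hl⟩ := hA.out f hf (e.symm.toLinearMap ∘ₗ g)
  exact ⟨e.toLinearMap ∘ₗ l, fun x ↦ (congr_arg e (hl x)).trans (e.apply_symm_apply _)⟩⟩

/-- For `C` with `R ≅ Hom(C, C)` and `J` injective, `Hom(C, J) ⊗ C` is injective. -/
lemma injective_hom_tensor [IsNoetherianRing R] [Module.Finite R C]
    (hbij : Function.Bijective (LinearMap.lsmul R C)) (hJ : Module.Injective R J) :
    Module.Injective R ((C →ₗ[R] J) ⊗[R] C) :=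
  injective_of_linearEquiv ((LinearMap.ringLmapEquivSelf R R J).symm ≪≫ₗ
    (LinearEquiv.ofBijective (LinearMap.lsmul R C) hbij).congrLeft J R ≪≫ₗ
    (LinearEquiv.ofBijective _ (homEval_bijective (R := R) (K := C) (C := C) (J := J))).symm ≪≫ₗ
    TensorProduct.comm R _ _) hJ

end

section

variable {R : Type u} [CommRing R]

lemma isCInjective_of_subsingleton (C M : ModuleCat.{u} R) [Subsingleton M] :
    IsCInjective R C M := by
  have : Module.Injective R M := ⟨fun _ _ _ _ _ _ _ _ g ↦ ⟨0, fun _ ↦ Subsingleton.elim _ _⟩⟩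
  refine ⟨M, this, ⟨LinearEquiv.ofBijective (0 : M →ₗ[R] (C →ₗ[R] M))
    ⟨Function.injective_of_subsingleton _, fun f ↦ ⟨0, LinearMap.ext fun _ ↦ ?_⟩⟩⟩⟩
  exact Subsingleton.elim _ _

/-- `Ext` between `C`-injective modules vanishes in positive degrees. -/
lemma IsCInjective.extVanish [IsNoetherianRing R] {C M N : ModuleCat.{u} R} [Module.Finite R C]
    (hext : ∀ i, 1 ≤ i → ExtVanish R C C i) (hM : IsCInjective R C M) (hN : IsCInjective R C N)
    {i : ℕ} (hi : 1 ≤ i) : ExtVanish R M N i := by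
  obtain ⟨I, hI, ⟨e⟩⟩ := hM
  obtain ⟨J, hJ, ⟨f⟩⟩ := hN
  obtain ⟨i, rfl⟩ := Nat.exists_eq_add_of_le' hi
  exact .congr_left e (.congr_right f (.hom_hom hI hJ i C hext))

/-- An injective module containing `M`. -/
noncomputable def injHull (M : ModuleCat.{u} R) : ModuleCat.{u} R :=
  (exists_injective_embedding R M).choose

/-- An embedding of `M` in an injective module. -/
noncomputable def injHullι (M : ModuleCat.{u} R) : M →ₗ[R] injHull M :=
  (exists_injective_embedding R M).choose_spec.choose

lemma injHull_injective (M : ModuleCat.{u} R) : Module.Injective R (injHull M) :=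
  (exists_injective_embedding R M).choose_spec.choose_spec.1

lemma injHullι_injective (M : ModuleCat.{u} R) : Function.Injective (injHullι M) :=
  (exists_injective_embedding R M).choose_spec.choose_spec.2

/-- The iterated cosyzygies of `M`. -/
noncomputable def cosyzygy (M : ModuleCat.{u} R) : ℕ → ModuleCat.{u} R
  | 0 => M
  | n + 1 => ModuleCat.of R (injHull (cosyzygy M n) ⧸ LinearMap.range (injHullι (cosyzygy M n)))

/-- The projection of an injective module onto the next cosyzygy. -/
noncomputable def cosyzygyπ (M : ModuleCat.{u} R) (n : ℕ) :
    injHull (cosyzygy M n) →ₗ[R] cosyzygy M (n + 1) :=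
  (LinearMap.range (injHullι (cosyzygy M n))).mkQ

/-- The differentials of an injective coresolution of `M`. -/
noncomputable def cosyzygyD (M : ModuleCat.{u} R) (n : ℕ) :
    injHull (cosyzygy M n) →ₗ[R] injHull (cosyzygy M (n + 1)) :=
  injHullι _ ∘ₗ cosyzygyπ M n

variable {M : ModuleCat.{u} R}

lemma cosyzygyπ_surjective (n : ℕ) : Function.Surjective (cosyzygyπ M n) :=
  Submodule.mkQ_surjective _

lemma exact_cosyzygy (n : ℕ) : Function.Exact (injHullι (cosyzygy M n)) (cosyzygyπ M n) :=
  LinearMap.exact_map_mkQ_range _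

lemma cosyzygyD_eq_zero_iff (n : ℕ) (x : injHull (cosyzygy M n)) :
    cosyzygyD M n x = 0 ↔ cosyzygyπ M n x = 0 :=
  map_eq_zero_iff _ (injHullι_injective _)

lemma exact_injHullι_cosyzygyD (n : ℕ) :
    Function.Exact (injHullι (cosyzygy M n)) (cosyzygyD M n) := fun x ↦
  (cosyzygyD_eq_zero_iff n x).trans (exact_cosyzygy n x)

lemma exact_cosyzygyD (n : ℕ) : Function.Exact (cosyzygyD M n) (cosyzygyD M (n + 1)) := fun x ↦ by
  rw [exact_injHullι_cosyzygyD]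
  constructor
  · rintro ⟨y, rfl⟩
    obtain ⟨z, rfl⟩ := cosyzygyπ_surjective n y
    exact ⟨z, rfl⟩
  · rintro ⟨z, rfl⟩
    exact ⟨cosyzygyπ M n z, rfl⟩

variable {U : ModuleCat.{u} R}

lemma extVanish_cosyzygy (h : ∀ i, 1 ≤ i → ExtVanish R U M i) (n : ℕ) :
    ∀ i, 1 ≤ i → ExtVanish R U (cosyzygy M n) i := by
  induction n with
  | zero => exact h
  | succ n ih =>
    have := injHull_injective (cosyzygy M n)
    exact fun i hi ↦ ExtVanish.co_right (injHullι_injective _) (exact_cosyzygy n)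
      (cosyzygyπ_surjective n) (.of_injective hi) (ih _ (by omega))

lemma hom_exact_injHullι (n : ℕ) : Function.Exact
    (fun f : U →ₗ[R] cosyzygy M n ↦ (injHullι (cosyzygy M n)).comp f)
    (fun f : U →ₗ[R] injHull (cosyzygy M n) ↦ (cosyzygyD M n).comp f) := fun f ↦ by
  constructor
  · intro hf
    choose g hg using fun u ↦ (exact_injHullι_cosyzygyD n (f u)).1 (LinearMap.congr_fun hf u)
    refine ⟨{ toFun := g, map_add' := fun a b ↦ injHullι_injective _ ?_,
              map_smul' := fun a b ↦ injHullι_injective _ ?_ }, LinearMap.ext hg⟩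
    · rw [map_add, hg, hg, hg, map_add]
    · rw [RingHom.id_apply, map_smul, hg, hg, map_smul]
  · rintro ⟨g, rfl⟩
    exact LinearMap.ext fun u ↦ (exact_injHullι_cosyzygyD n).apply_apply_eq_zero (g u)

lemma hom_exact_cosyzygyD (h : ∀ i, 1 ≤ i → ExtVanish R U M i) (n : ℕ) : Function.Exact
    (fun f : U →ₗ[R] injHull (cosyzygy M n) ↦ (cosyzygyD M n).comp f)
    (fun f : U →ₗ[R] injHull (cosyzygy M (n + 1)) ↦ (cosyzygyD M (n + 1)).comp f) := fun f ↦ by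
  rw [hom_exact_injHullι]
  constructor
  · rintro ⟨g, rfl⟩
    obtain ⟨l, rfl⟩ := ExtVanish.exists_lift (injHullι_injective _) (exact_cosyzygy n)
      (cosyzygyπ_surjective n) (extVanish_cosyzygy h n 1 le_rfl) g
    exact ⟨l, rfl⟩
  · rintro ⟨l, rfl⟩
    exact ⟨cosyzygyπ M n ∘ₗ l, rfl⟩

variable (M) in
/-- The terms of the complete resolution of a `C`-injective module `M`. -/
noncomputable def resolutionY : ℤ → ModuleCat.{u} R
  | Int.ofNat 0 => injHull (cosyzygy M 0)
  | Int.ofNat 1 => M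
  | Int.ofNat (_ + 2) => ModuleCat.of R PUnit
  | Int.negSucc n => injHull (cosyzygy M (n + 1))

variable (M) in
/-- The differentials of the complete resolution of a `C`-injective module `M`. -/
noncomputable def resolutionD : (i : ℤ) → (resolutionY M (i + 1) →ₗ[R] resolutionY M i)
  | Int.ofNat 0 => injHullι (cosyzygy M 0)
  | Int.ofNat (_ + 1) => 0
  | Int.negSucc 0 => cosyzygyD M 0
  | Int.negSucc (n + 1) => cosyzygyD M (n + 1)

lemma exact_resolutionD : ∀ i : ℤ, Function.Exact (resolutionD M (i + 1)) (resolutionD M i)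
  | Int.ofNat 0 => fun _ ↦ ⟨fun h ↦ ⟨PUnit.unit, (injHullι_injective M (h.trans
      (map_zero (injHullι M)).symm)).symm⟩, fun ⟨_, h⟩ ↦
        (congr_arg (injHullι M) h.symm).trans (map_zero (injHullι M))⟩
  | Int.ofNat (_ + 1) => fun _ ↦ ⟨fun _ ↦ ⟨PUnit.unit, rfl⟩, fun _ ↦ rfl⟩
  | Int.negSucc 0 => exact_injHullι_cosyzygyD 0
  | Int.negSucc 1 => exact_cosyzygyD 0
  | Int.negSucc (n + 2) => exact_cosyzygyD (n + 1)

lemma hom_exact_resolutionD (h : ∀ i, 1 ≤ i → ExtVanish R U M i) :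
    ∀ i : ℤ, Function.Exact
      (fun f : U →ₗ[R] resolutionY M (i + 1 + 1) ↦ (resolutionD M (i + 1)).comp f)
      (fun f : U →ₗ[R] resolutionY M (i + 1) ↦ (resolutionD M i).comp f)
  | Int.ofNat 0 => fun _ ↦ ⟨fun hf ↦ ⟨0, LinearMap.ext fun u ↦
      (injHullι_injective M ((LinearMap.congr_fun hf u).trans (map_zero (injHullι M)).symm)).symm⟩,
      fun ⟨_, hg⟩ ↦ LinearMap.ext fun u ↦
        (congr_arg (injHullι M) (LinearMap.congr_fun hg u).symm).trans (map_zero (injHullι M))⟩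
  | Int.ofNat (_ + 1) => fun _ ↦ ⟨fun _ ↦ ⟨0, LinearMap.ext fun _ ↦ rfl⟩,
      fun _ ↦ LinearMap.ext fun _ ↦ rfl⟩
  | Int.negSucc 0 => hom_exact_injHullι 0
  | Int.negSucc 1 => hom_exact_cosyzygyD h 0
  | Int.negSucc (n + 2) => hom_exact_cosyzygyD h (n + 1)

/-- A `C`-injective module is `G_C`-injective. -/
lemma IsCInjective.isGCInjective [IsNoetherianRing R] {C : ModuleCat.{u} R} [Module.Finite R C]
    (hext : ∀ i, 1 ≤ i → ExtVanish R C C i) (hM : IsCInjective R C M) : IsGCInjective R C M := by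
  refine ⟨⟨resolutionY M, resolutionD M, exact_resolutionD, fun i hi ↦ ?_, fun i hi ↦ ?_,
    fun U hU ↦ hom_exact_resolutionD fun i hi ↦ hU.extVanish hext hM hi⟩, ⟨?_⟩⟩
  · match i, hi with
    | Int.ofNat 1, _ => exact hM
    | Int.ofNat (_ + 2), _ =>
      exact isCInjective_of_subsingleton C (ModuleCat.of R PUnit)
  · match i, hi with
    | Int.ofNat 0, _ => exact injHull_injective _
    | Int.negSucc n, _ => exact injHull_injective _
  · exact (LinearEquiv.ofInjective _ (injHullι_injective M)).trans
      (LinearEquiv.ofEq _ _ (LinearMap.exact_iff.1 (exact_injHullι_cosyzygyD 0)).symm)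

end

section

variable {R : Type u} [CommRing R]

/-- `0 → A → B → D → 0` is short exact. -/
structure IsShortExact {A B D : Type u} [AddCommGroup A] [Module R A] [AddCommGroup B]
    [Module R B] [AddCommGroup D] [Module R D] (f : A →ₗ[R] B) (g : B →ₗ[R] D) : Prop where
  injective : Function.Injective f
  exact : Function.Exact f g
  surjective : Function.Surjective g

section

variable {A B D A' D' X Y Z W : Type u} [AddCommGroup A] [Module R A] [AddCommGroup B] [Module R B]
  [AddCommGroup D] [Module R D] [AddCommGroup A'] [Module R A'] [AddCommGroup D'] [Module R D']
  [AddCommGroup X] [Module R X] [AddCommGroup Y] [Module R Y] [AddCommGroup Z] [Module R Z]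
  [AddCommGroup W] [Module R W]

lemma exists_comp_eq_of_forall_mem_range {f : A →ₗ[R] B} (hf : Function.Injective f)
    (h : X →ₗ[R] B) (hh : ∀ x, h x ∈ LinearMap.range f) : ∃ l : X →ₗ[R] A, f ∘ₗ l = h :=
  ⟨(LinearEquiv.ofInjective f hf).symm.toLinearMap ∘ₗ h.codRestrict _ hh, LinearMap.ext fun x ↦
    congr_arg Subtype.val ((LinearEquiv.ofInjective f hf).apply_symm_apply ⟨h x, hh x⟩)⟩

/-- The two short exact sequences ending at a pullback. -/
lemma IsShortExact.exists_pullback {f : A →ₗ[R] B} {g : B →ₗ[R] D} (h : IsShortExact f g)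
    {f' : A' →ₗ[R] W} {g' : W →ₗ[R] D} (h' : IsShortExact f' g') :
    ∃ (P : ModuleCat.{u} R) (a : A →ₗ[R] P) (b : P →ₗ[R] W) (a' : A' →ₗ[R] P) (b' : P →ₗ[R] B),
      IsShortExact a b ∧ IsShortExact a' b' := by
  let P := LinearMap.eqLocus (g ∘ₗ LinearMap.fst R B W) (g' ∘ₗ LinearMap.snd R B W)
  refine ⟨ModuleCat.of R P,
    (LinearMap.inl R B W ∘ₗ f).codRestrict P fun x ↦
      (h.exact.apply_apply_eq_zero x).trans (map_zero g').symm,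
    LinearMap.snd R B W ∘ₗ P.subtype,
    (LinearMap.inr R B W ∘ₗ f').codRestrict P fun x ↦
      (map_zero g).trans (h'.exact.apply_apply_eq_zero x).symm,
    LinearMap.fst R B W ∘ₗ P.subtype, ⟨fun x y hxy ↦ ?_, ?_, fun w ↦ ?_⟩,
    ⟨fun x y hxy ↦ ?_, ?_, fun w ↦ ?_⟩⟩
  · exact h.injective (congr_arg (fun z : P ↦ z.1.1) hxy)
  · rintro ⟨⟨b, w⟩, hbw⟩
    constructor
    · rintro rfl
      obtain ⟨a, rfl⟩ := (h.exact b).1 (hbw.trans (map_zero g'))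
      exact ⟨a, rfl⟩
    · rintro ⟨a, ha⟩
      exact congr_arg (fun z : P ↦ z.1.2) ha.symm
  · obtain ⟨b, hb⟩ := h.surjective (g' w)
    exact ⟨⟨(b, w), hb⟩, rfl⟩
  · exact h'.injective (congr_arg (fun z : P ↦ z.1.2) hxy)
  · rintro ⟨⟨b, w⟩, hbw⟩
    constructor
    · rintro rfl
      obtain ⟨a, rfl⟩ := (h'.exact w).1 (hbw.symm.trans (map_zero g))
      exact ⟨a, rfl⟩
    · rintro ⟨a, ha⟩
      exact congr_arg (fun z : P ↦ z.1.1) ha.symm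
  · obtain ⟨b, hb⟩ := h'.surjective (g w)
    exact ⟨⟨(w, b), hb.symm⟩, rfl⟩

/-- The preimage of a submodule under a surjection. -/
lemma IsShortExact.exists_preimage {f : A →ₗ[R] B} {g : B →ₗ[R] D} (h : IsShortExact f g)
    {k : X →ₗ[R] Y} {q : Y →ₗ[R] B} (h' : IsShortExact k q) :
    ∃ (W : ModuleCat.{u} R) (i : W →ₗ[R] Y) (j : X →ₗ[R] W) (p : W →ₗ[R] A),
      IsShortExact i (g ∘ₗ q) ∧ IsShortExact j p := by
  let W := LinearMap.ker (g ∘ₗ q)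
  obtain ⟨p, hp⟩ := exists_comp_eq_of_forall_mem_range h.injective (q ∘ₗ W.subtype)
    fun x ↦ (h.exact _).1 x.2
  replace hp := LinearMap.congr_fun hp
  refine ⟨ModuleCat.of R W, W.subtype, k.codRestrict W fun x ↦
    (congr_arg g (h'.exact.apply_apply_eq_zero x)).trans (map_zero g), p,
    ⟨W.subtype_injective, LinearMap.exact_subtype_ker_map _, h.surjective.comp h'.surjective⟩,
    ⟨fun x y hxy ↦ h'.injective (congr_arg Subtype.val hxy), fun w ↦ ?_, fun a ↦ ?_⟩⟩
  · constructor
    · intro hw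
      obtain ⟨x, hx⟩ := (h'.exact w.1).1 ((hp w).symm.trans ((congr_arg f hw).trans (map_zero f)))
      exact ⟨x, Subtype.ext hx⟩
    · rintro ⟨x, rfl⟩
      exact h.injective ((hp _).trans ((h'.exact.apply_apply_eq_zero x).trans (map_zero f).symm))
  · obtain ⟨y, hy⟩ := h'.surjective (f a)
    refine ⟨⟨y, ?_⟩, h.injective ((hp _).trans hy)⟩
    exact (congr_arg g hy).trans (h.exact.apply_apply_eq_zero a)

/-- The horseshoe lemma. -/
lemma IsShortExact.exists_horseshoe {f : A →ₗ[R] B} {g : B →ₗ[R] D} (h : IsShortExact f g)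
    {k : A' →ₗ[R] X} {q : X →ₗ[R] A} (h₁ : IsShortExact k q)
    {k' : D' →ₗ[R] Y} {q' : Y →ₗ[R] D} (h₂ : IsShortExact k' q') (hE : ExtVanish R Y A 1) :
    ∃ (K : ModuleCat.{u} R) (i : K →ₗ[R] (X × Y)) (p : (X × Y) →ₗ[R] B)
      (a : A' →ₗ[R] K) (b : K →ₗ[R] D'), IsShortExact i p ∧ IsShortExact a b := by
  obtain ⟨l, hl⟩ := ExtVanish.exists_lift h.injective h.exact h.surjective hE q'
  replace hl := LinearMap.congr_fun hl
  let p : (X × Y) →ₗ[R] B := LinearMap.coprod (f ∘ₗ q) l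
  have hp : ∀ x y, p (x, y) = f (q x) + l y := fun x y ↦ rfl
  let K := LinearMap.ker p
  have hgp : ∀ z, g (p z) = q' z.2 := fun z ↦ by
    rw [hp, map_add, h.exact.apply_apply_eq_zero, zero_add]
    exact hl z.2
  obtain ⟨b, hb⟩ := exists_comp_eq_of_forall_mem_range h₂.injective
    (LinearMap.snd R X Y ∘ₗ K.subtype) fun z ↦ (h₂.exact _).1 <| by
      refine (hgp _).symm.trans ((congr_arg g z.2).trans (map_zero g))
  replace hb := LinearMap.congr_fun hb
  refine ⟨ModuleCat.of R K, K.subtype, p, (LinearMap.inl R X Y ∘ₗ k).codRestrict K fun x ↦ ?_, b,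
    ⟨K.subtype_injective, LinearMap.exact_subtype_ker_map _, fun z ↦ ?_⟩,
    ⟨fun x y hxy ↦ h₁.injective (congr_arg (fun z : K ↦ z.1.1) hxy), fun z ↦ ?_, fun d ↦ ?_⟩⟩
  · change p (k x, 0) = 0
    rw [hp, h₁.exact.apply_apply_eq_zero, map_zero, map_zero, add_zero]
  · obtain ⟨y, hy⟩ := h₂.surjective (g z)
    obtain ⟨a, ha⟩ := (h.exact (z - l y)).1 (by
      rw [map_sub, ← hy, sub_eq_zero]; exact (hl y).symm)
    obtain ⟨x, rfl⟩ := h₁.surjective a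
    exact ⟨(x, y), by rw [hp, ha, sub_add_cancel]⟩
  · constructor
    · intro hz
      have h1 : z.1.2 = 0 := (hb z).symm.trans ((congr_arg k' hz).trans (map_zero k'))
      have h2 : f (q z.1.1) + l z.1.2 = 0 := z.2
      rw [h1, map_zero, add_zero, map_eq_zero_iff f h.injective] at h2
      obtain ⟨x, hx⟩ := (h₁.exact _).1 h2
      exact ⟨x, Subtype.ext (Prod.ext hx h1.symm)⟩
    · rintro ⟨x, rfl⟩
      exact h₂.injective ((hb _).trans (map_zero k').symm)
  · obtain ⟨a, ha⟩ := (h.exact (l (k' d))).1 ((hl _).trans (h₂.exact.apply_apply_eq_zero d))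
    obtain ⟨x, rfl⟩ := h₁.surjective a
    refine ⟨⟨(-x, k' d), ?_⟩, h₂.injective (hb _)⟩
    change p (-x, k' d) = 0
    rw [hp, map_neg, map_neg, ha, neg_add_cancel]

end

lemma IsCInjective.prod {C M N : ModuleCat.{u} R} (hM : IsCInjective R C M)
    (hN : IsCInjective R C N) : IsCInjective R C (ModuleCat.of R (M × N)) := by
  obtain ⟨I, hI, ⟨e⟩⟩ := hM
  obtain ⟨J, hJ, ⟨f⟩⟩ := hN
  refine ⟨ModuleCat.of R (I × J), ⟨fun _ _ _ _ _ _ i hi g ↦ ?_⟩,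
    ⟨(e.prodCongr f).trans (LinearMap.prodEquiv R)⟩⟩
  obtain ⟨k, hk⟩ := hI.out i hi (LinearMap.fst R I J ∘ₗ g)
  obtain ⟨l, hl⟩ := hJ.out i hi (LinearMap.snd R I J ∘ₗ g)
  exact ⟨k.prod l, fun x ↦ Prod.ext (hk x) (hl x)⟩

end

section

variable {R : Type u} [CommRing R] {C : ModuleCat.{u} R}

/-- `X` is right orthogonal to the `C`-injective modules and has `n` steps of a left resolution by
`C`-injective modules whose syzygies have the same property. -/
def HasCInjectiveResolution (C : ModuleCat.{u} R) : ℕ → ModuleCat.{u} R → Prop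
  | 0, X => ∀ U, IsCInjective R C U → ∀ i, 1 ≤ i → ExtVanish R U X i
  | n + 1, X => (∀ U, IsCInjective R C U → ∀ i, 1 ≤ i → ExtVanish R U X i) ∧
      ∃ (X' Z : ModuleCat.{u} R) (f : X' →ₗ[R] Z) (q : Z →ₗ[R] X),
        IsCInjective R C Z ∧ HasCInjectiveResolution C n X' ∧ IsShortExact f q

namespace HasCInjectiveResolution

variable {n : ℕ} {M X : ModuleCat.{u} R}

lemma extVanish (h : HasCInjectiveResolution C n X) :
    ∀ U, IsCInjective R C U → ∀ i, 1 ≤ i → ExtVanish R U X i := by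
  cases n with
  | zero => exact h
  | succ n => exact h.1

lemma of_linearEquiv (e : X ≃ₗ[R] M) (h : HasCInjectiveResolution C n X) :
    HasCInjectiveResolution C n M := by
  cases n with
  | zero => exact fun U hU i hi ↦ .congr_right e.symm (h U hU i hi)
  | succ n =>
    obtain ⟨h1, X', Z, f, q, hZ, hX', hs⟩ := h
    refine ⟨fun U hU i hi ↦ .congr_right e.symm (h1 U hU i hi), X', Z, f, e.toLinearMap ∘ₗ q, hZ,
      hX', hs.injective, fun z ↦ ?_, e.surjective.comp hs.surjective⟩
    exact (map_eq_zero_iff e e.injective).trans (hs.exact z)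

lemma of_subsingleton (C X : ModuleCat.{u} R) [Subsingleton X] :
    HasCInjectiveResolution C n X := by
  induction n with
  | zero => exact fun U _ i _ ↦ .of_subsingleton_right
  | succ n ih =>
    exact ⟨fun U _ i _ ↦ .of_subsingleton_right, X, X, LinearMap.id, LinearMap.id,
      isCInjective_of_subsingleton C X, ih, Function.injective_id,
      fun x ↦ ⟨fun _ ↦ ⟨x, rfl⟩, fun _ ↦ Subsingleton.elim _ _⟩, Function.surjective_id⟩

lemma of_isShortExact {A B D : ModuleCat.{u} R} {f : A →ₗ[R] B} {g : B →ₗ[R] D}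
    (h : IsShortExact f g) (hA : HasCInjectiveResolution C n A)
    (hD : HasCInjectiveResolution C n D) : HasCInjectiveResolution C n B := by
  have hB : ∀ U, IsCInjective R C U → ∀ i, 1 ≤ i → ExtVanish R U B i := fun U hU i hi ↦
    .co_mid h.injective h.exact h.surjective (hA.extVanish U hU i hi) (hD.extVanish U hU i hi)
  induction n generalizing A B D with
  | zero => exact hB
  | succ n ih =>
    obtain ⟨hA', X₁, Z₁, f₁, q₁, hZ₁, hX₁, hs₁⟩ := hA
    obtain ⟨hD', X₂, Z₂, f₂, q₂, hZ₂, hX₂, hs₂⟩ := hD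
    obtain ⟨K, i, p, a, b, hip, hab⟩ := h.exists_horseshoe hs₁ hs₂ (hA' Z₂ hZ₂ 1 le_rfl)
    refine ⟨hB, K, ModuleCat.of R (Z₁ × Z₂), i, p, hZ₁.prod hZ₂, ih hab hX₁ hX₂ ?_, hip⟩
    exact fun U hU i hi ↦ .co_mid hab.injective hab.exact hab.surjective
      (hX₁.extVanish U hU i hi) (hX₂.extVanish U hU i hi)

/-- Dimension shifting along a partial `C`-injective resolution. -/
lemma extVanish_chainModule {rs : List R} {D : Type u} [AddCommGroup D] [Module R D]
    (hD : IsChainModule C rs D) (h : HasCInjectiveResolution C n X) {j : ℕ} (hj : 1 ≤ j)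
    (hjn : rs.length < j + n) : ExtVanish R D X j := by
  induction n generalizing X j with
  | zero => exact hD.ext_length X j hjn
  | succ n ih =>
    obtain ⟨-, X', Z, f, q, ⟨I, hI, ⟨e⟩⟩, hX', hs⟩ := h
    exact .co_right hs.injective hs.exact hs.surjective (.congr_right e (hD.ext_hom I hI j hj))
      (ih hX' (by omega) (by omega))

end HasCInjectiveResolution

namespace CompleteICIResolution

variable (res : CompleteICIResolution R C)

/-- The syzygies of a complete resolution. -/
abbrev syzygy (i : ℤ) : ModuleCat.{u} R := ModuleCat.of R (LinearMap.ker (res.d i))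

/-- The differential of a complete resolution, as a map to the next syzygy. -/
def toSyzygy (i : ℤ) : res.Y (i + 1 + 1) →ₗ[R] res.syzygy i :=
  (res.d (i + 1)).codRestrict (LinearMap.ker (res.d i)) (res.exact i).apply_apply_eq_zero

lemma isShortExact (i : ℤ) :
    IsShortExact (LinearMap.ker (res.d (i + 1))).subtype (res.toSyzygy i) where
  injective := Submodule.subtype_injective _
  exact x := by
    rw [Subtype.ext_iff]
    exact LinearMap.exact_subtype_ker_map (res.d (i + 1)) x
  surjective x := by
    obtain ⟨y, hy⟩ := (res.exact i x.1).1 x.2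
    exact ⟨y, Subtype.ext hy⟩

lemma extVanish_syzygy [IsNoetherianRing R] [Module.Finite R C]
    (hext : ∀ i, 1 ≤ i → ExtVanish R C C i) {U : ModuleCat.{u} R} (hU : IsCInjective R C U)
    {j : ℕ} (hj : 1 ≤ j) (i : ℤ) : ExtVanish R U (res.syzygy i) j := by
  have hY (k : ℤ) {j : ℕ} (hj : 1 ≤ j) : ExtVanish R U (res.Y k) j := by
    by_cases hk : 0 < k
    · exact hU.extVanish hext (res.cinj_pos k hk) hj
    · have := res.inj_nonpos k (by omega)
      exact .of_injective hj
  induction j, hj using Nat.le_induction generalizing i with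
  | base =>
    obtain ⟨i, rfl⟩ : ∃ k, i = k + 1 := ⟨i - 1, by omega⟩
    have hs := res.isShortExact i
    refine ExtVanish.of_exists_lift hs.injective hs.exact hs.surjective (hY _ le_rfl) fun k ↦ ?_
    obtain ⟨l, hl⟩ := (res.homExact U hU i ((LinearMap.ker (res.d i)).subtype ∘ₗ k)).1
      (LinearMap.ext fun u ↦ (k u).2)
    exact ⟨l, LinearMap.ext fun u ↦ Subtype.ext (LinearMap.congr_fun hl u)⟩
  | succ j hj ih =>
    obtain ⟨i, rfl⟩ : ∃ k, i = k + 1 := ⟨i - 1, by omega⟩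
    have hs := res.isShortExact i
    exact ExtVanish.co_left hs.injective hs.exact hs.surjective (hY _ (by omega)) (ih i)

lemma hasCInjectiveResolution_syzygy [IsNoetherianRing R] [Module.Finite R C]
    (hext : ∀ i, 1 ≤ i → ExtVanish R C C i) (n : ℕ) {i : ℤ} (hi : -1 ≤ i) :
    HasCInjectiveResolution C n (res.syzygy i) := by
  induction n generalizing i with
  | zero => exact fun U hU j hj ↦ res.extVanish_syzygy hext hU hj i
  | succ n ih =>
    exact ⟨fun U hU j hj ↦ res.extVanish_syzygy hext hU hj i, _, _, _, _,
      res.cinj_pos (i + 1 + 1) (by omega), ih (by omega), res.isShortExact i⟩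

end CompleteICIResolution

lemma IsGCInjective.hasCInjectiveResolution [IsNoetherianRing R] [Module.Finite R C]
    (hext : ∀ i, 1 ≤ i → ExtVanish R C C i) {M : ModuleCat.{u} R} (h : IsGCInjective R C M)
    (n : ℕ) : HasCInjectiveResolution C n M := by
  obtain ⟨res, ⟨e⟩⟩ := h
  exact (res.hasCInjectiveResolution_syzygy hext n le_rfl).of_linearEquiv
    (X := res.syzygy (-1)) e.symm

/-- `W` is acyclic for `Hom(-, Hom(C, I))` with `I` injective, and `W ⊗ C` has finite injective
dimension. -/
def HasFiniteTensorInjDim (C W : ModuleCat.{u} R) : Prop :=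
  (∀ I : ModuleCat.{u} R, Module.Injective R I → ∀ i, 1 ≤ i → ExtVanish R W (C →ₗ[R] I) i) ∧
    ∃ N : ℕ, ∀ (T : ModuleCat.{u} R) (i : ℕ), N < i → ExtVanish R T (W ⊗[R] C) i

lemma IsCInjective.hasFiniteTensorInjDim [IsNoetherianRing R] [Module.Finite R C]
    (hbij : Function.Bijective (LinearMap.lsmul R C))
    (hext : ∀ i, 1 ≤ i → ExtVanish R C C i) {Z : ModuleCat.{u} R} (hZ : IsCInjective R C Z) :
    HasFiniteTensorInjDim C Z := by
  refine ⟨fun I hI i hi ↦ hZ.extVanish hext (N := ModuleCat.of R (C →ₗ[R] I))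
    ⟨I, hI, ⟨.refl R _⟩⟩ hi, 0, fun T i hi ↦ ?_⟩
  obtain ⟨J, hJ, ⟨e⟩⟩ := hZ
  have := injective_hom_tensor hbij hJ
  exact .congr_right (TensorProduct.congr e (.refl R C)) (.of_injective hi)

lemma HasFiniteTensorInjDim.of_isShortExact [IsNoetherianRing R] [Module.Finite R C]
    (hbij : Function.Bijective (LinearMap.lsmul R C))
    (hext : ∀ i, 1 ≤ i → ExtVanish R C C i) {W Y W' : ModuleCat.{u} R} {f : W →ₗ[R] Y}
    {g : Y →ₗ[R] W'} (h : IsShortExact f g) (hY : IsCInjective R C Y)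
    (hW' : HasFiniteTensorInjDim C W') : HasFiniteTensorInjDim C W := by
  obtain ⟨hY1, NY, hY2⟩ := hY.hasFiniteTensorInjDim hbij hext
  obtain ⟨hW1, N, hW2⟩ := hW'
  refine ⟨fun I hI i hi ↦ .contra_left h.injective h.exact h.surjective (hY1 I hI i hi)
    (hW1 I hI (i + 1) (by omega)), max N NY + 1, fun T i hi ↦ ?_⟩
  obtain ⟨i, rfl⟩ := Nat.exists_eq_add_of_le' (Nat.one_le_of_lt hi)
  have hinj : Function.Injective (f.rTensor C) := by
    refine rTensor_injective_of_exists_extend fun I _ _ hI k ↦ ?_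
    exact ExtVanish.exists_extend h.injective h.exact h.surjective
      (hW1 (ModuleCat.of R I) hI 1 le_rfl) k
  exact .co_left hinj (rTensor_exact C h.exact h.surjective)
    (LinearMap.rTensor_surjective C h.surjective) (hY2 T _ (by omega)) (hW2 T i (by omega))

/-- A module of finite `G_C`-injective dimension is a quotient of a module `W` such that `W ⊗ C`
has finite injective dimension, by a kernel with long partial `C`-injective resolutions. -/
lemma exists_isShortExact_of_hasCoresDimLE [IsNoetherianRing R] [Module.Finite R C]
    (hbij : Function.Bijective (LinearMap.lsmul R C)) (hext : ∀ i, 1 ≤ i → ExtVanish R C C i)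
    (d : ℕ) (n : ℕ) (M : ModuleCat.{u} R) (h : HasCoresDimLE R (IsGCInjective R C) d M) :
    ∃ (X W : ModuleCat.{u} R) (f : X →ₗ[R] W) (g : W →ₗ[R] M),
      IsShortExact f g ∧ HasCInjectiveResolution C n X ∧ HasFiniteTensorInjDim C W := by
  have base (M : ModuleCat.{u} R) (h : HasCInjectiveResolution C (n + 1) M) :
      ∃ (X W : ModuleCat.{u} R) (f : X →ₗ[R] W) (g : W →ₗ[R] M),
        IsShortExact f g ∧ HasCInjectiveResolution C n X ∧ HasFiniteTensorInjDim C W := by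
    obtain ⟨-, X, Z, f, q, hZ, hX, hs⟩ := h
    exact ⟨X, Z, f, q, hs, hX, hZ.hasFiniteTensorInjDim hbij hext⟩
  induction d generalizing n M with
  | zero =>
    rcases h with h | h
    · exact base M (.of_subsingleton C M)
    · exact base M (h.hasCInjectiveResolution hext _)
  | succ d ih =>
    rcases h with h | ⟨G, f, hG, hf, h⟩
    · exact base M (.of_subsingleton C M)
    have hs : IsShortExact f (LinearMap.range f).mkQ :=
      ⟨hf, LinearMap.exact_map_mkQ_range f, Submodule.mkQ_surjective _⟩
    obtain ⟨X', W', f', g', hs', hX', hW'⟩ := ih (n + 1) _ h fun M h ↦ by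
      obtain ⟨-, X, Z, f, q, hZ, hX, hs⟩ := h
      exact ⟨X, Z, f, q, hs, hX, hZ.hasFiniteTensorInjDim hbij hext⟩
    obtain ⟨P, a, b, a', b', hab, hab'⟩ := hs.exists_pullback hs'
    obtain ⟨-, X, Y, k, q, hY, hX, hkq⟩ : HasCInjectiveResolution C (n + 1) P :=
      .of_isShortExact hab' hX' (hG.hasCInjectiveResolution hext _)
    obtain ⟨W, i, j, p, h1, h2⟩ := hab.exists_preimage hkq
    exact ⟨X, W, j, p, h2, hX, .of_isShortExact hbij hext h1 hY hW'⟩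

end

section

variable {R : Type u} [CommRing R]

lemma coresDim_ne_top_iff {P : ModuleCat.{u} R → Prop} {M : ModuleCat.{u} R} :
    coresDim R P M ≠ ⊤ ↔ ∃ n, HasCoresDimLE R P n M := by
  rw [coresDim, Ne, sInf_eq_top]
  push Not
  constructor
  · rintro ⟨_, ⟨n, -, hn⟩, -⟩
    exact ⟨n, hn⟩
  · rintro ⟨n, hn⟩
    exact ⟨n, ⟨n, rfl, hn⟩, ENat.natCast_ne_top n⟩

/-- If `D` is a quotient of a module `W` such that `W ⊗ C` has finite injective dimension, by a
kernel with a long partial `C`-injective resolution, then the `Ext` modules from torsion modules to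
`C` vanish in large degrees. -/
lemma IsChainModule.exists_forall_extVanish [IsNoetherianRing R] {C : ModuleCat.{u} R}
    [Module.Finite R C] (hbij : Function.Bijective (LinearMap.lsmul R C))
    (hext : ∀ i, 1 ≤ i → ExtVanish R C C i) {rs : List R} {D : Type u} [AddCommGroup D]
    [Module R D] (hD : IsChainModule C rs D) {M : ModuleCat.{u} R} (e : D ≃ₗ[R] M) {d : ℕ}
    (h : HasCoresDimLE R (IsGCInjective R C) d M) :
    ∃ N : ℕ, ∀ T : ModuleCat.{u} R, TorsBy rs T → ∀ i, N < i → ExtVanish R T C i := by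
  obtain ⟨X, W, f, g, hs, hX, -, N, hW⟩ :=
    exists_isShortExact_of_hasCoresDimLE hbij hext d rs.length M h
  obtain ⟨s, hs'⟩ := ExtVanish.exists_lift hs.injective hs.exact hs.surjective
    (hX.extVanish_chainModule hD le_rfl (by omega)) e.toLinearMap
  obtain ⟨ε, hε⟩ := hD.shift_tensor
  refine ⟨N + rs.length, fun T hT i hi ↦ ?_⟩
  obtain ⟨j, rfl⟩ := Nat.exists_eq_add_of_le' (show rs.length ≤ i by omega)
  refine (hε.extVanish hT rfl).1 (ExtVanish.retract_right (s.rTensor C)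
    ((e.symm.toLinearMap ∘ₗ g).rTensor C) ?_ (hW T j (by omega)))
  rw [← LinearMap.rTensor_comp, LinearMap.comp_assoc, hs', LinearEquiv.symm_comp,
    LinearMap.rTensor_id]

end

end

noncomputable section
open CategoryTheory TensorProduct

/-- For a Cohen-Macaulay local ring of dimension `n` and a semidualizing
module `C`: `C` is dualizing iff `H_m^n(R)` is `C`-injective, iff `H_m^n(R)` is
`G_C`-injective, iff `G_C-id_R H_m^n(R)` is finite. -/
theorem stmt_9 (R : Type u) [CommRing R] [IsNoetherianRing R] [IsLocalRing R]
    (hCM : IsCohenMacaulayLocalRing R) (n : ℕ)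
    (hdim : ringKrullDim R = (n : WithBot ℕ∞))
    (C : ModuleCat.{u} R) (hC : IsSemidualizing R C) :
    (IsDualizing R C ↔ IsCInjective R C
      ((localCohomology (IsLocalRing.maximalIdeal R) n).obj (ModuleCat.of R R))) ∧
    (IsDualizing R C ↔ IsGCInjective R C
      ((localCohomology (IsLocalRing.maximalIdeal R) n).obj (ModuleCat.of R R))) ∧
    (IsDualizing R C ↔ gcinjDim R C
      ((localCohomology (IsLocalRing.maximalIdeal R) n).obj (ModuleCat.of R R)) ≠ ⊤) := by
  have hfin : Module.Finite R C := hC.1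
  have hbij := hC.2.1
  have hext : ∀ i, 1 ≤ i → ExtVanish R C C i := fun i hi ↦
    have := hC.2.2 i hi
    (extComparison C C i).symm.toEquiv.subsingleton
  obtain ⟨rs, rfl, hmem, hreg⟩ := exists_isWeaklyRegular_of_ext n R <|
    ExtVanish.residueField_of_localCohomology fun i hi ↦ hCM i <| by
      rw [hdim]
      exact_mod_cast hi.ne
  obtain ⟨t, ht⟩ := exists_pow_le_ofList hdim rfl hmem hreg
  obtain ⟨D, _, _, hD⟩ := exists_isChainModule hbij hext rs hreg
  obtain ⟨e⟩ := hD.nonempty_equiv hmem ht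
  have h12 : IsDualizing R C → IsCInjective R C ((localCohomology
      (IsLocalRing.maximalIdeal R) rs.length).obj (ModuleCat.of R R)) := fun h ↦ by
    obtain ⟨N, hN⟩ := coresDim_ne_top_iff.1 h.2
    exact ⟨ModuleCat.of R (D ⊗[R] C), hD.injective_tensor hmem hreg ht fun i hi ↦
      ExtVanish.of_hasCoresDimLE_injective N C hN _ i hi, ⟨e.symm ≪≫ₗ hD.unitEquiv⟩⟩
  have h23 := fun h ↦ IsCInjective.isGCInjective (M := (localCohomology
    (IsLocalRing.maximalIdeal R) rs.length).obj (ModuleCat.of R R)) hext h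
  have h34 : IsGCInjective R C ((localCohomology
      (IsLocalRing.maximalIdeal R) rs.length).obj (ModuleCat.of R R)) → gcinjDim R C
      ((localCohomology (IsLocalRing.maximalIdeal R) rs.length).obj (ModuleCat.of R R)) ≠ ⊤ :=
    fun h ↦ coresDim_ne_top_iff.2 ⟨0, Or.inr h⟩
  have h41 : gcinjDim R C ((localCohomology (IsLocalRing.maximalIdeal R) rs.length).obj
      (ModuleCat.of R R)) ≠ ⊤ → IsDualizing R C := fun h ↦ by
    obtain ⟨d, hd⟩ := coresDim_ne_top_iff.1 h
    obtain ⟨N, hN⟩ := hD.exists_forall_extVanish hbij hext e hd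
    have hk : TorsBy rs (R ⧸ IsLocalRing.maximalIdeal R) :=
      torsBy_of_pow_smul hmem (s := 1) fun r hr ↦ by
        rintro ⟨x⟩
        rw [pow_one] at hr
        exact (Submodule.Quotient.mk_eq_zero _).2 (Ideal.mul_mem_right _ _ hr)
    refine ⟨hC, coresDim_ne_top_iff.2 ⟨N, hasCoresDimLE_injective_of_ext N C fun a ↦ ?_⟩⟩
    exact ExtVanish.quotient_of_residueField
      (fun j hj ↦ hN (ModuleCat.of R (R ⧸ IsLocalRing.maximalIdeal R)) hk j hj) a _ (by omega)
  exact ⟨⟨h12, fun h ↦ h41 (h34 (h23 h))⟩, ⟨fun h ↦ h23 (h12 h), fun h ↦ h41 (h34 h)⟩,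
    ⟨fun h ↦ h34 (h23 (h12 h)), h41⟩⟩

end
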